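/- arXiv:2511.09267 — 2 statements merged into one kernel-verified Lean document; each statement's English description precedes it below -/
import Mathlib

section
/- Let A be an M_K(ℂ)-valued trigonometric polynomial of bidegree at most (w, M). If for every separable complex Hilbert space F and every unitary representation π of the direct product group F_g × 𝔜 on F the operator A(π) is positive definite, then there exist positive integers K′ and M′ and an analytic polynomial B of bidegree at most (w, M′) with coefficients in the K′×K complex matrices such that A = B*B; that is, for every α ∈ F_g × 𝔜 the coefficient A_α (set equal to 0 when α ∉ Her W_{≤w} × Her 𝒴_{≤M}) equals the sum of B_β* B_γ over all pairs β, γ ∈ W_{≤w} × 𝒴_{≤M′} with β⁻¹γ = α. -/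
open scoped ComplexInnerProductSpace
open Matrix

/-- The strict shortlex order on words over the alphabet `Fin n`:
first compare lengths, ties broken by the lexicographic order. -/
def ShortlexLT {n : ℕ} (a b : List (Fin n)) : Prop :=
  a.length < b.length ∨ (a.length = b.length ∧ List.Lex (· < ·) a b)

/-- The shortlex order on words over the alphabet `Fin n`. -/
def ShortlexLE {n : ℕ} (a b : List (Fin n)) : Prop :=
  ShortlexLT a b ∨ a = b

/-- The image of a word in the free group. -/
def wordF {g : ℕ} (l : List (Fin g)) : FreeGroup (Fin g) :=
  (l.map FreeGroup.of).prod

/-- `W_{≤ w}`: the image in the free group of the set of words `≤ w` in shortlex. -/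
def WleF {g : ℕ} (w : List (Fin g)) : Set (FreeGroup (Fin g)) :=
  {a | ∃ l : List (Fin g), ShortlexLE l w ∧ wordF l = a}

/-- `Her W_{≤ w} = {u⁻¹ v : u, v ∈ W_{≤ w}}`. -/
def HerWleF {g : ℕ} (w : List (Fin g)) : Set (FreeGroup (Fin g)) :=
  {α | ∃ u ∈ WleF w, ∃ v ∈ WleF w, u⁻¹ * v = α}

/-- `𝒴_{≤ M}`: products of at most `M` of the generators `y`. -/
def Yle {h : ℕ} {Y : Type*} [Group Y] (y : Fin h → Y) (M : ℕ) : Set Y :=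
  {a | ∃ l : List (Fin h), l.length ≤ M ∧ (l.map y).prod = a}

/-- `Her 𝒴_{≤ M} = {a⁻¹ b : a, b ∈ 𝒴_{≤ M}}`. -/
def HerYle {h : ℕ} {Y : Type*} [Group Y] (y : Fin h → Y) (M : ℕ) : Set Y :=
  {η | ∃ a ∈ Yle y M, ∃ b ∈ Yle y M, a⁻¹ * b = η}

section FejerRiesz

open scoped ComplexOrder

/-- Kolmogorov decomposition of a positive semidefinite kernel. -/
theorem exists_gram_eq_of_posSemidef {P : Type} [Countable P] {k : Matrix P P ℂ}
    (hk : k.PosSemidef) :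
    ∃ (H : Type) (_ : NormedAddCommGroup H) (_ : InnerProductSpace ℂ H) (_ : CompleteSpace H)
      (_ : TopologicalSpace.SeparableSpace H) (e : P → H),
      (∀ p q, ⟪e p, e q⟫ = k p q) ∧
      (Submodule.span ℂ (Set.range e)).topologicalClosure = ⊤ := by
  let core : PreInnerProductSpace.Core ℂ (P →₀ ℂ) :=
    { inner := fun f g => f.sum fun p z => g.sum fun q w => star z * k p q * w
      conj_inner_symm := fun f g => by
        rw [Finsupp.sum_comm]
        simp only [map_finsuppSum]
        refine Finsupp.sum_congr fun p _ => Finsupp.sum_congr fun q _ => ?_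
        rw [← hk.isHermitian.apply p q]
        simp; ring
      re_inner_nonneg := fun f => by
        have := hk.2 f
        exact (Complex.le_def.1 this).1
      add_left := fun f g l => by
        rw [Finsupp.sum_add_index'] <;> simp [← Finsupp.sum_add, add_mul]
      smul_left := fun f g r => by
        rw [Finsupp.sum_smul_index] <;> simp [Finsupp.mul_sum, ← mul_assoc] }
  let : SeminormedAddCommGroup (P →₀ ℂ) :=
    InnerProductSpace.Core.toSeminormedAddCommGroup (𝕜 := ℂ)
  let : InnerProductSpace ℂ (P →₀ ℂ) := .ofCore core
  have hin : ∀ f g : P →₀ ℂ, ⟪f, g⟫ = f.sum fun p z => g.sum fun q w => star z * k p q * w :=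
    fun f g => rfl
  let e : P → UniformSpace.Completion (P →₀ ℂ) :=
    fun p => ((Finsupp.single p 1 : P →₀ ℂ) : UniformSpace.Completion (P →₀ ℂ))
  have htot : (Submodule.span ℂ (Set.range e)).topologicalClosure = ⊤ := by
    rw [Submodule.topologicalClosure_eq_top_iff, Submodule.eq_bot_iff]
    intro x hx
    refine UniformSpace.Completion.denseRange_coe.eq_zero_of_inner_right ℂ fun f => ?_
    induction f using Finsupp.induction_linear with
    | zero => rw [UniformSpace.Completion.coe_zero, inner_zero_left]
    | add f g hf hg => rw [UniformSpace.Completion.coe_add, inner_add_left, hf, hg, add_zero]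
    | single p z =>
      have : (Finsupp.single p z : P →₀ ℂ) = z • Finsupp.single p 1 := by simp
      rw [this, UniformSpace.Completion.coe_smul, inner_smul_left,
        (Submodule.mem_orthogonal _ _).1 hx (e p) (Submodule.subset_span ⟨p, rfl⟩), mul_zero]
  refine ⟨UniformSpace.Completion (P →₀ ℂ), inferInstance, inferInstance, inferInstance, ?_, e,
    fun p q => ?_, htot⟩
  · have h := ((Set.countable_range e).isSeparable.span (R := ℂ)).closure
    rw [← Submodule.topologicalClosure_coe, htot, Submodule.top_coe] at h
    exact TopologicalSpace.isSeparable_univ_iff.1 h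
  · rw [UniformSpace.Completion.inner_coe, hin]
    simp

variable {H : Type*} [NormedAddCommGroup H] [InnerProductSpace ℂ H] [CompleteSpace H]

theorem ContinuousLinearMap.ext_range_orthogonal {E ι : Type*} [NormedAddCommGroup E]
    [NormedSpace ℂ E] {a : ι → H} {S T : H →L[ℂ] E}
    (hrange : ∀ i, S (a i) = T (a i))
    (horth : ∀ x, (∀ i, ⟪a i, x⟫ = 0) → S x = T x) : S = T := by
  have hle : (Submodule.span ℂ (Set.range a)).topologicalClosure ≤
      LinearMap.eqLocus S.toLinearMap T.toLinearMap := by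
    refine Submodule.topologicalClosure_minimal _ (Submodule.span_le.2 ?_) ?_
    · rintro _ ⟨i, rfl⟩
      exact hrange i
    · exact isClosed_eq S.continuous T.continuous
  ext x
  obtain ⟨u, hu, v, hv, rfl⟩ := Submodule.exists_add_mem_mem_orthogonal
    (K := (Submodule.span ℂ (Set.range a)).topologicalClosure) x
  rw [map_add, map_add, show S u = T u from hle hu, horth v fun i => ?_]
  exact (Submodule.mem_orthogonal _ _).1 hv _
    (Submodule.le_topologicalClosure _ (Submodule.subset_span ⟨i, rfl⟩))

/-- Two families with the same Gram matrix are intertwined by a partial isometry that vanishes on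
the orthogonal complement of the first family. -/
theorem exists_partialIsometry_of_gram_eq {ι : Type*} {a b : ι → H}
    (hab : ∀ i j, ⟪a i, a j⟫ = ⟪b i, b j⟫) :
    ∃ V : H →L[ℂ] H, (∀ i, V (a i) = b i) ∧ (∀ x, (∀ i, ⟪a i, x⟫ = 0) → V x = 0) ∧
      ∀ x, ‖V x‖ ≤ ‖x‖ := by
  set D := (Submodule.span ℂ (Set.range a)).topologicalClosure with hD
  have hmem : ∀ c, Finsupp.linearCombination ℂ a c ∈ D := fun c =>
    Submodule.le_topologicalClosure _ (Finsupp.mem_span_range_iff_exists_finsupp.2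
      ⟨c, (Finsupp.linearCombination_apply ℂ c).symm⟩)
  let f : (ι →₀ ℂ) →ₗ[ℂ] D := (Finsupp.linearCombination ℂ a).codRestrict D hmem
  have hdense : DenseRange f := by
    rintro ⟨x, hx⟩
    rw [closure_subtype]
    rw [hD, ← SetLike.mem_coe, Submodule.topologicalClosure_coe] at hx
    refine closure_mono ?_ hx
    intro z hz
    obtain ⟨c, rfl⟩ := Finsupp.mem_span_range_iff_exists_finsupp.1 hz
    exact ⟨f c, ⟨c, rfl⟩, Finsupp.linearCombination_apply ℂ c⟩
  have hnorm : ∀ c, ‖Finsupp.linearCombination ℂ b c‖ ≤ 1 * ‖f c‖ := by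
    intro c
    rw [one_mul]
    refine le_of_eq ?_
    change _ = ‖Finsupp.linearCombination ℂ a c‖
    rw [← sq_eq_sq₀ (norm_nonneg _) (norm_nonneg _), ← inner_self_eq_norm_sq (𝕜 := ℂ),
      ← inner_self_eq_norm_sq (𝕜 := ℂ)]
    simp only [Finsupp.linearCombination_apply, Finsupp.sum_inner, Finsupp.inner_sum, hab,
      inner_smul_left, inner_smul_right]
  let V := ((Finsupp.linearCombination ℂ b).extendOfNorm f) ∘L D.orthogonalProjectionOnto
  refine ⟨V, fun i => ?_, fun x hx => ?_, fun x => ?_⟩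
  · have hi : f (Finsupp.single i 1) = ⟨a i, by simpa using hmem (Finsupp.single i 1)⟩ := by
      ext; simp [f]
    have := LinearMap.extendOfNorm_eq hdense ⟨1, hnorm⟩ (Finsupp.single i 1)
    rw [hi] at this
    simp only [V, ContinuousLinearMap.comp_apply]
    rw [show D.orthogonalProjectionOnto (a i) = ⟨a i, by simpa using hmem (Finsupp.single i 1)⟩ from
      Submodule.orthogonalProjectionOnto_mem_subspace_eq_self (K := D) ⟨a i, _⟩, this]
    simp
  · have hxD : x ∈ Dᗮ := by
      rw [hD, Submodule.orthogonal_closure, Submodule.mem_orthogonal]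
      intro u hu
      induction hu using Submodule.span_induction with
      | mem u hu => obtain ⟨i, rfl⟩ := hu; exact hx i
      | zero => simp
      | add u v _ _ hu hv => rw [inner_add_left, hu, hv, add_zero]
      | smul c u _ hu => rw [inner_smul_left, hu, mul_zero]
    simp [V, Submodule.orthogonalProjectionOnto_apply_of_mem_orthogonal hxD]
  · calc ‖V x‖ ≤ 1 * ‖D.orthogonalProjectionOnto x‖ :=
          LinearMap.norm_extendOfNorm_apply_le hdense 1 hnorm _
      _ ≤ ‖x‖ := by rw [one_mul]; exact D.norm_orthogonalProjectionOnto_apply_le x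

theorem adjoint_apply_apply_of_gram_eq {ι : Type*} {a b : ι → H}
    (hab : ∀ i j, ⟪a i, a j⟫ = ⟪b i, b j⟫) {V : H →L[ℂ] H} (hVa : ∀ i, V (a i) = b i)
    (hV : ∀ x, (∀ i, ⟪a i, x⟫ = 0) → V x = 0) (i : ι) :
    ContinuousLinearMap.adjoint V (V (a i)) = a i := by
  refine (innerSL_inj (𝕜 := ℂ)).1 (ContinuousLinearMap.ext_range_orthogonal (a := a) ?_ ?_)
  · intro j
    simp [ContinuousLinearMap.adjoint_inner_left, hVa, hab]
  · intro x hx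
    simp [ContinuousLinearMap.adjoint_inner_left, hV x hx, hx]

/-- A Gram-invariant total family indexed by left translates of a group carries a unitary
representation of this group. -/
theorem exists_unitary_rep_of_total {G Q : Type*} [Group G] {e : G × Q → H}
    (htot : (Submodule.span ℂ (Set.range e)).topologicalClosure = ⊤)
    (he : ∀ s x y q r, ⟪e (s * x, q), e (s * y, r)⟫ = ⟪e (x, q), e (y, r)⟫) :
    ∃ ρ : G →* (H ≃ₗᵢ[ℂ] H), ∀ s x q, ρ s (e (x, q)) = e (s * x, q) := by
  have hV : ∀ s : G, ∃ V : H →L[ℂ] H, (∀ p : G × Q, V (e p) = e (s * p.1, p.2)) ∧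
      ∀ x, ‖V x‖ ≤ ‖x‖ := fun s => by
    obtain ⟨V, h1, -, h2⟩ := exists_partialIsometry_of_gram_eq (a := e)
      (b := fun p => e (s * p.1, p.2)) fun p q => (he s p.1 q.1 p.2 q.2).symm
    exact ⟨V, h1, h2⟩
  choose V hVe hVn using hV
  have hext : ∀ S T : H →L[ℂ] H, (∀ p, S (e p) = T (e p)) → S = T := fun S T h => by
    refine ContinuousLinearMap.ext_on ((Submodule.dense_iff_topologicalClosure_eq_top).2 htot) ?_
    rintro _ ⟨p, rfl⟩
    exact h p
  have hmul : ∀ s t x, V (s * t) x = V s (V t x) := fun s t x =>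
    DFunLike.congr_fun (hext (V (s * t)) (V s ∘L V t) fun p => by simp [hVe, mul_assoc]) x
  have hone : ∀ x, V 1 x = x := fun x =>
    DFunLike.congr_fun (hext (V 1) (.id ℂ H) fun p => by simp [hVe]) x
  have hinv : ∀ s x, V s (V s⁻¹ x) = x := fun s x => by rw [← hmul, mul_inv_cancel, hone]
  have hinv' : ∀ s x, V s⁻¹ (V s x) = x := fun s x => by rw [← hmul, inv_mul_cancel, hone]
  refine ⟨{ toFun := fun s =>
              { toLinearEquiv := LinearEquiv.ofLinearMap (V s).toLinearMap (V s⁻¹).toLinearMap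
                  (LinearMap.ext (hinv s)) (LinearMap.ext (hinv' s))
                norm_map' := fun x => le_antisymm (hVn s x) ?_ }
            map_one' := LinearIsometryEquiv.ext hone
            map_mul' := fun s t => LinearIsometryEquiv.ext (hmul s t) },
    fun s x q => hVe s (x, q)⟩
  calc ‖x‖ = ‖V s⁻¹ (V s x)‖ := by rw [hinv']
    _ ≤ ‖V s x‖ := hVn _ _

/-- The Halmos dilation of a partial isometry. -/
theorem exists_halmos_dilation (V : H →L[ℂ] H)
    (hV : ∀ x, V (ContinuousLinearMap.adjoint V (V x)) = V x) :
    ∃ U : WithLp 2 (H × H) ≃ₗᵢ[ℂ] WithLp 2 (H × H), ∀ a b, U (WithLp.toLp 2 (a, b)) =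
      WithLp.toLp 2 (V a + (b - V (ContinuousLinearMap.adjoint V b)),
        a - ContinuousLinearMap.adjoint V (V a) - ContinuousLinearMap.adjoint V b) := by
  set A := ContinuousLinearMap.adjoint V with hA
  have hVl : ∀ x y, ⟪V x, y⟫ = ⟪x, A y⟫ := fun x y =>
    (ContinuousLinearMap.adjoint_inner_right V x y).symm
  have hAl : ∀ x y, ⟪A x, y⟫ = ⟪x, V y⟫ := fun x y =>
    ContinuousLinearMap.adjoint_inner_left V y x
  have hA' : ∀ x, A (V (A x)) = A x := fun x => ext_inner_right ℂ fun z => by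
    rw [hAl, hVl, hAl, hV, hAl]
  let T : (H →L[ℂ] H) → (H →L[ℂ] H) → WithLp 2 (H × H) →ₗ[ℂ] WithLp 2 (H × H) := fun V A =>
    { toFun := fun p =>
        WithLp.toLp 2 (V p.fst + (p.snd - V (A p.snd)), p.fst - A (V p.fst) - A p.snd)
      map_add' := fun p q => WithLp.ofLp_injective 2 <| Prod.ext
        (by simp only [WithLp.add_fst, WithLp.add_snd, map_add, WithLp.ofLp_add,
          Prod.fst_add]; abel)
        (by simp only [WithLp.add_fst, WithLp.add_snd, map_add, WithLp.ofLp_add,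
          Prod.snd_add]; abel)
      map_smul' := fun c p => WithLp.ofLp_injective 2 <| Prod.ext
        (by simp [smul_add, smul_sub]) (by simp [smul_sub]) }
  have hinv : ∀ V A : H →L[ℂ] H, (∀ x, V (A (V x)) = V x) → (∀ x, A (V (A x)) = A x) →
      T V A ∘ₗ T A V = .id := fun V A hV hA => by
    refine LinearMap.ext fun p => ?_
    refine WithLp.ofLp_injective 2 (Prod.ext ?_ ?_)
    · simp [T, hV, hA]
    · simp [T, hV, hA]
  refine ⟨{ toLinearEquiv := LinearEquiv.ofLinearMap (T V A) (T A V) (hinv V A hV hA')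
              (hinv A V hA' hV)
            norm_map' := fun p => ?_ }, fun a b => rfl⟩
  change ‖T V A p‖ = ‖p‖
  rw [← sq_eq_sq₀ (norm_nonneg _) (norm_nonneg _), ← inner_self_eq_norm_sq (𝕜 := ℂ),
    ← inner_self_eq_norm_sq (𝕜 := ℂ)]
  congr 1
  simp only [T, WithLp.prod_inner_apply, LinearMap.coe_mk, AddHom.coe_mk, inner_add_left,
    inner_sub_left, hVl, hAl, hV, hA', inner_add_right, inner_sub_right]
  change _ = ⟪p.fst, p.fst⟫ + ⟪p.snd, p.snd⟫
  ring

theorem commute_adjoint_of_commute {V : H →L[ℂ] H} {R : H ≃ₗᵢ[ℂ] H}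
    (h : ∀ x, V (R x) = R (V x)) (x : H) :
    ContinuousLinearMap.adjoint V (R x) = R (ContinuousLinearMap.adjoint V x) := by
  have h' : ∀ z, V (R.symm z) = R.symm (V z) := fun z => by
    rw [LinearIsometryEquiv.eq_symm_apply, ← h, R.apply_symm_apply]
  refine ext_inner_right ℂ fun z => ?_
  have hR : ∀ u v, ⟪R u, v⟫ = ⟪u, R.symm v⟫ := fun u v => by
    rw [← R.inner_map_map u, R.apply_symm_apply]
  rw [ContinuousLinearMap.adjoint_inner_left, hR, hR, ContinuousLinearMap.adjoint_inner_left, h']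

/-- A unitary representation of `G` together with a family of commuting partial isometries
dilates to a unitary representation of the product of `G` with a free group. -/
theorem exists_dilation_freeGroup_prod {G ι : Type*} [Group G] (ρ : G →* (H ≃ₗᵢ[ℂ] H))
    (V : ι → H →L[ℂ] H)
    (hV : ∀ i x, V i (ContinuousLinearMap.adjoint (V i) (V i x)) = V i x)
    (hρ : ∀ i s x, V i (ρ s x) = ρ s (V i x)) :
    ∃ π : FreeGroup ι × G →* (WithLp 2 (H × H) ≃ₗᵢ[ℂ] WithLp 2 (H × H)),
      (∀ s x, π (1, s) (WithLp.toLp 2 (x, 0)) = WithLp.toLp 2 (ρ s x, 0)) ∧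
      ∀ i x, ContinuousLinearMap.adjoint (V i) (V i x) = x →
        π (FreeGroup.of i, 1) (WithLp.toLp 2 (x, 0)) = WithLp.toLp 2 (V i x, 0) := by
  choose U hU using fun i => exists_halmos_dilation (V i) (hV i)
  let ρ₂ : G →* (WithLp 2 (H × H) ≃ₗᵢ[ℂ] WithLp 2 (H × H)) :=
    { toFun := fun s => (ρ s).withLpProdCongr 2 (ρ s)
      map_one' := LinearIsometryEquiv.ext fun p => by rw [map_one]; rfl
      map_mul' := fun s t => LinearIsometryEquiv.ext fun p => by simp }
  have hρ₂ : ∀ s a b, ρ₂ s (WithLp.toLp 2 (a, b)) = WithLp.toLp 2 (ρ s a, ρ s b) :=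
    fun s a b => rfl
  have hcomm : ∀ u s, Commute (FreeGroup.lift U u) (ρ₂ s) := by
    intro u s
    induction u using FreeGroup.induction_on with
    | C1 => simp
    | of i =>
      rw [FreeGroup.lift_apply_of]
      refine LinearIsometryEquiv.ext fun p => ?_
      obtain ⟨a, b⟩ := p
      change U i (ρ₂ s (WithLp.toLp 2 (a, b))) = ρ₂ s (U i (WithLp.toLp 2 (a, b)))
      simp only [hρ₂, hU, hρ i s, commute_adjoint_of_commute (hρ i s), map_add, map_sub]
    | inv_of i h => rw [map_inv]; exact h.inv_left
    | mul u v hu hv => rw [map_mul]; exact hu.mul_left hv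
  refine ⟨(FreeGroup.lift U).noncommCoprod ρ₂ hcomm, fun s x => ?_, fun i x hx => ?_⟩
  · simp [MonoidHom.noncommCoprod_apply, hρ₂]
  · simp [MonoidHom.noncommCoprod_apply, hU, hx]

/-- Gelfand–Naimark–Segal construction on the words of a suffix-closed language, times a group. -/
theorem exists_rep_of_posSemidef {g K : ℕ} {Y : Type} [Group Y] [Countable Y]
    {L : Set (List (Fin g))} (hnil : [] ∈ L) (hL : ∀ a l, a :: l ∈ L → l ∈ L)
    (f : FreeGroup (Fin g) × Y → Matrix (Fin K) (Fin K) ℂ)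
    (hf : Matrix.PosSemidef fun p q : Y × ((wordF '' L) × Fin K) =>
      f ((p.2.1 : FreeGroup (Fin g))⁻¹ * q.2.1, p.1⁻¹ * q.1) p.2.2 q.2.2) :
    ∃ (F : Type) (_ : NormedAddCommGroup F) (_ : InnerProductSpace ℂ F) (_ : CompleteSpace F)
      (_ : TopologicalSpace.SeparableSpace F)
      (π : FreeGroup (Fin g) × Y →* (F ≃ₗᵢ[ℂ] F)) (ξ : Fin K → F),
      ∀ u ∈ wordF '' L, ∀ v ∈ wordF '' L, ∀ s i j,
        ⟪ξ i, π (u⁻¹ * v, s) (ξ j)⟫ = f (u⁻¹ * v, s) i j := by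
  have : Countable (FreeGroup (Fin g)) := Quotient.countable
  obtain ⟨H, _, _, _, _, e, he, htot⟩ := exists_gram_eq_of_posSemidef hf
  obtain ⟨ρ, hρ⟩ := exists_unitary_rep_of_total (G := Y) (e := e) htot fun s x y q r => by
    simp [he, mul_assoc]
  have hV : ∀ i : Fin g, ∃ V : H →L[ℂ] H,
      (∀ (s : Y) (u : wordF '' L) (k : Fin K) (hu : FreeGroup.of i * u.1 ∈ wordF '' L),
        V (e (s, u, k)) = e (s, ⟨_, hu⟩, k) ∧
        ContinuousLinearMap.adjoint V (V (e (s, u, k))) = e (s, u, k)) ∧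
      (∀ x, V (ContinuousLinearMap.adjoint V (V x)) = V x) ∧
      ∀ s x, V (ρ s x) = ρ s (V x) := by
    intro i
    let a : {p : Y × ((wordF '' L) × Fin K) // FreeGroup.of i * p.2.1.1 ∈ wordF '' L} → H :=
      fun p => e p.1
    let b : {p : Y × ((wordF '' L) × Fin K) // FreeGroup.of i * p.2.1.1 ∈ wordF '' L} → H :=
      fun p => e (p.1.1, ⟨_, p.2⟩, p.1.2.2)
    have hab : ∀ p q, ⟪a p, a q⟫ = ⟪b p, b q⟫ := fun p q => by
      simp [a, b, he, mul_assoc]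
    obtain ⟨V, hVa, hVo, -⟩ := exists_partialIsometry_of_gram_eq hab
    have hVV := adjoint_apply_apply_of_gram_eq hab hVa hVo
    refine ⟨V, fun s u k hu => ⟨hVa ⟨(s, u, k), hu⟩, hVV ⟨(s, u, k), hu⟩⟩, fun x => ?_,
      fun s x => ?_⟩
    · refine DFunLike.congr_fun (ContinuousLinearMap.ext_range_orthogonal (a := a)
        (S := V ∘L ContinuousLinearMap.adjoint V ∘L V) (T := V) (fun p => ?_) fun z hz => ?_) x
      · simp [hVV]
      · simp [hVo z hz]
    · refine DFunLike.congr_fun (ContinuousLinearMap.ext_range_orthogonal (a := a)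
        (S := V ∘L (ρ s : H →L[ℂ] H)) (T := (ρ s : H →L[ℂ] H) ∘L V) (fun p => ?_)
        fun z hz => ?_) x
      · obtain ⟨⟨t, u, k⟩, hu⟩ := p
        have h1 := hVa ⟨(t, u, k), hu⟩
        have h2 := hVa ⟨(s * t, u, k), hu⟩
        simp only [a, b] at h1 h2
        simp [a, hρ, h1, h2]
      · have hz' : ∀ p, ⟪a p, ρ s z⟫ = 0 := by
          rintro ⟨⟨t, u, k⟩, hu⟩
          have h1 := hz ⟨(s⁻¹ * t, u, k), hu⟩
          rwa [← (ρ s).inner_map_map, hρ, mul_inv_cancel_left] at h1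
        simp [hVo z hz, hVo _ hz']
  choose V hVe hVV hVρ using hV
  obtain ⟨π, hπY, hπF⟩ := exists_dilation_freeGroup_prod ρ V hVV hVρ
  have h1 : (1 : FreeGroup (Fin g)) ∈ wordF '' L := ⟨[], hnil, rfl⟩
  have hword : ∀ (l : List (Fin g)) (hl : l ∈ L) (s : Y) (k : Fin K),
      π (wordF l, 1) (WithLp.toLp 2 (e (s, ⟨1, h1⟩, k), 0)) =
        WithLp.toLp 2 (e (s, ⟨wordF l, l, hl, rfl⟩, k), 0) := by
    intro l
    induction l with
    | nil =>
      intro hl s k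
      change π 1 _ = _
      rw [map_one]
      rfl
    | cons a l ih =>
      intro hl s k
      have hcons : wordF (a :: l) = FreeGroup.of a * wordF l := by simp [wordF]
      have hmem : FreeGroup.of a * wordF l ∈ wordF '' L := ⟨a :: l, hl, hcons⟩
      have hsplit : (wordF (a :: l), (1 : Y)) = (FreeGroup.of a, 1) * (wordF l, 1) := by
        rw [hcons, Prod.mk_mul_mk, mul_one]
      obtain ⟨hV1, hV2⟩ := hVe a s ⟨wordF l, l, hL a l hl, rfl⟩ k hmem
      rw [hsplit, map_mul, LinearIsometryEquiv.coe_mul, Function.comp_apply, ih (hL a l hl),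
        hπF a _ hV2, hV1]
      simp only [hcons]
  refine ⟨WithLp 2 (H × H), inferInstance, inferInstance, inferInstance, inferInstance, π,
    fun k => WithLp.toLp 2 (e (1, ⟨1, h1⟩, k), 0), ?_⟩
  rintro _ ⟨l, hl, rfl⟩ _ ⟨m, hm, rfl⟩ s i j
  have hsplit : ((wordF l)⁻¹ * wordF m, s) = (wordF l, (1 : Y))⁻¹ * ((wordF m, 1) * (1, s)) := by
    simp
  have hξ : π ((wordF l)⁻¹ * wordF m, s) (WithLp.toLp 2 (e (1, ⟨1, h1⟩, j), 0)) =
      (π (wordF l, 1)).symm (WithLp.toLp 2 (e (s, ⟨wordF m, m, hm, rfl⟩, j), 0)) := by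
    rw [hsplit, map_mul, map_mul, map_inv, LinearIsometryEquiv.coe_mul, LinearIsometryEquiv.coe_mul,
      Function.comp_apply, Function.comp_apply, hπY, hρ, hword m hm, mul_one]
    rfl
  rw [hξ, ← (π (wordF l, 1)).inner_map_map, LinearIsometryEquiv.apply_symm_apply, hword l hl]
  simp [WithLp.prod_inner_apply, he]

/-- The coefficients of a trigonometric polynomial all of whose evaluations have real quadratic form
satisfy the hermitian symmetry. -/
theorem apply_inv_eq_conjTranspose_of_im_eq_zero {G : Type} [Group G] [Countable G] {K : ℕ}
    (S : Finset G) (A : G → Matrix (Fin K) (Fin K) ℂ) (hA : ∀ α ∉ S, A α = 0)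
    (hreal : ∀ (F : Type) [NormedAddCommGroup F] [InnerProductSpace ℂ F] [CompleteSpace F]
      [TopologicalSpace.SeparableSpace F] (π : G →* (F ≃ₗᵢ[ℂ] F)) (ξ : Fin K → F),
      (∑ α ∈ S, ∑ i, ∑ j, A α i j * ⟪ξ i, π α (ξ j)⟫).im = 0) (α₀ : G) :
    A α₀⁻¹ = (A α₀)ᴴ := by
  classical
  obtain ⟨F, _, _, _, _, e, he, htot⟩ :=
    exists_gram_eq_of_posSemidef (P := G × Unit) (k := 1) Matrix.PosSemidef.one
  obtain ⟨π, hπ⟩ := exists_unitary_rep_of_total htot fun s x y q r => by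
    simp [he, Matrix.one_apply]
  set Q : (Fin K → F) → (Fin K → F) → ℂ := fun ξ η =>
    ∑ α ∈ S, ∑ i, ∑ j, A α i j * ⟪ξ i, π α (η j)⟫ with hQ
  have hadd : ∀ ξ η (c : ℂ), Q (ξ + c • η) (ξ + c • η) =
      Q ξ ξ + c * Q ξ η + star c * Q η ξ + star c * c * Q η η := fun ξ η c => by
    simp only [hQ, Finset.mul_sum, ← Finset.sum_add_distrib]
    refine Finset.sum_congr rfl fun α _ => Finset.sum_congr rfl fun i _ =>
      Finset.sum_congr rfl fun j _ => ?_
    simp only [Pi.add_apply, Pi.smul_apply, map_add, map_smul, inner_add_left, inner_add_right,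
      inner_smul_left, inner_smul_right, Complex.star_def]
    ring
  have hsymm : ∀ ξ η, Q η ξ = star (Q ξ η) := fun ξ η => by
    have h0 := hreal F π ξ
    have h0' := hreal F π η
    have h1 := hreal F π (ξ + (1 : ℂ) • η)
    have h2 := hreal F π (ξ + Complex.I • η)
    change (Q _ _).im = 0 at h0 h0' h1 h2
    rw [hadd] at h1 h2
    apply Complex.ext
    · simp [h0, h0'] at h1 h2 ⊢
      linarith
    · simp [h0, h0'] at h1 h2 ⊢
      linarith
  have hev : ∀ x y i₀ j₀, Q (Pi.single i₀ (e (x, ()))) (Pi.single j₀ (e (y, ()))) =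
      A (x * y⁻¹) i₀ j₀ := fun x y i₀ j₀ => by
    have hG : ∀ α, ⟪e (x, ()), π α (e (y, ()))⟫ = if α = x * y⁻¹ then 1 else 0 := fun α => by
      have hα : (x, ()) = (α * y, ()) ↔ α = x * y⁻¹ := by
        rw [Prod.mk_left_inj, eq_mul_inv_iff_mul_eq, eq_comm]
      rw [hπ, he, Matrix.one_apply]
      simp only [hα]
    have hinner : ∀ α i j, A α i j * ⟪(Pi.single i₀ (e (x, ())) : Fin K → F) i,
        π α ((Pi.single j₀ (e (y, ())) : Fin K → F) j)⟫ =
        if j = j₀ then if i = i₀ then if α = x * y⁻¹ then A α i j else 0 else 0 else 0 :=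
      fun α i j => by
        rcases eq_or_ne i i₀ with rfl | hi
        · rcases eq_or_ne j j₀ with rfl | hj
          · rw [Pi.single_eq_same, Pi.single_eq_same, hG]
            simp
          · simp [hj]
        · simp [hi]
    have hsum : Q (Pi.single i₀ (e (x, ()))) (Pi.single j₀ (e (y, ()))) = ∑ α ∈ S, ∑ i, ∑ j,
        if j = j₀ then if i = i₀ then if α = x * y⁻¹ then A α i j else 0 else 0 else 0 :=
      Finset.sum_congr rfl fun α _ => Finset.sum_congr rfl fun i _ =>
        Finset.sum_congr rfl fun j _ => hinner α i j
    rw [hsum]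
    simp only [Finset.sum_ite_eq', Finset.mem_univ, if_true]
    split_ifs with hxy
    · rfl
    · rw [hA _ hxy]; rfl
  ext i j
  have := hsymm (Pi.single j (e (α₀, ()))) (Pi.single i (e (1, ())))
  rw [hev, hev] at this
  simpa using this

/-- The formal Gram expression of two finitely supported coefficient families, whose `(p, q)` entry
is collected at the cell `cell p q`. -/
noncomputable def gramForm {P C : Type*} (cell : P → P → C) (b b' : P →₀ ℂ) : C →₀ ℂ :=
  b.sum fun p z => b'.sum fun q w => Finsupp.single (cell p q) (star z * w)

/-- The cone of sums of hermitian squares. -/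
noncomputable def sosCone {P C : Type*} (cell : P → P → C) : AddSubmonoid (C →₀ ℂ) :=
  AddSubmonoid.closure (Set.range fun b => gramForm cell b b)

section SumOfSquares

variable {P C : Type*} {cell : P → P → C}

theorem gramForm_add_left (b₁ b₂ b' : P →₀ ℂ) :
    gramForm cell (b₁ + b₂) b' = gramForm cell b₁ b' + gramForm cell b₂ b' := by
  unfold gramForm
  rw [Finsupp.sum_add_index'] <;> simp [← Finsupp.sum_add, add_mul]

theorem gramForm_add_right (b b₁ b₂ : P →₀ ℂ) :
    gramForm cell b (b₁ + b₂) = gramForm cell b b₁ + gramForm cell b b₂ := by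
  unfold gramForm
  rw [← Finsupp.sum_add]
  refine Finsupp.sum_congr fun p _ => ?_
  rw [Finsupp.sum_add_index'] <;> simp [mul_add]

theorem gramForm_single (p q : P) (z w : ℂ) :
    gramForm cell (Finsupp.single p z) (Finsupp.single q w) =
      Finsupp.single (cell p q) (star z * w) := by
  simp [gramForm]

theorem gramForm_smul (r : ℝ) (b b' : P →₀ ℂ) :
    gramForm cell (r • b) (r • b') = (r ^ 2) • gramForm cell b b' := by
  unfold gramForm
  rw [Finsupp.sum_smul_index' (by simp), Finsupp.smul_sum]
  refine Finsupp.sum_congr fun p _ => ?_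
  rw [Finsupp.sum_smul_index' (by simp), Finsupp.smul_sum]
  refine Finsupp.sum_congr fun q _ => ?_
  rw [Finsupp.smul_single]
  congr 1
  simp only [Complex.real_smul, star_mul', Complex.star_def, Complex.conj_ofReal]
  push_cast
  ring

theorem gramForm_mem_sosCone (b : P →₀ ℂ) : gramForm cell b b ∈ sosCone cell :=
  AddSubmonoid.subset_closure ⟨b, rfl⟩

theorem smul_mem_sosCone {r : ℝ} (hr : 0 ≤ r) {S : C →₀ ℂ} (hS : S ∈ sosCone cell) :
    r • S ∈ sosCone cell := by
  induction hS using AddSubmonoid.closure_induction with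
  | mem S hS =>
    obtain ⟨b, rfl⟩ := hS
    have := gramForm_mem_sosCone (cell := cell) (√r • b)
    rwa [gramForm_smul, Real.sq_sqrt hr] at this
  | zero => rw [smul_zero]; exact zero_mem _
  | add S T _ _ hS hT => rw [smul_add]; exact add_mem hS hT

theorem single_mem_sosCone (p : P) : Finsupp.single (cell p p) 1 ∈ sosCone cell := by
  have := gramForm_mem_sosCone (cell := cell) (Finsupp.single p 1)
  rwa [gramForm_single, star_one, one_mul] at this

theorem apply_eq_zero_of_mem_sosCone {S : C →₀ ℂ} (hS : S ∈ sosCone cell) {c : C}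
    (hc : ∀ p q, cell p q ≠ c) : S c = 0 := by
  induction hS using AddSubmonoid.closure_induction with
  | mem S hS =>
    obtain ⟨b, rfl⟩ := hS
    simp [gramForm, Finsupp.sum, Finsupp.finsetSum_apply, hc]
  | zero => rfl
  | add S T _ _ hS hT => rw [Finsupp.add_apply, hS, hT, add_zero]

variable {inv : C → C} {ι : Type*} [Fintype ι] {u : ι → P}

theorem star_single_apply_inv (hinv : Function.Involutive inv) (c c' : C) (z : ℂ) :
    star (Finsupp.single c z (inv c')) = Finsupp.single (inv c) (star z) c' := by
  classical
  have hiff : c = inv c' ↔ inv c = c' := hinv.eq_iff.symm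
  simp only [Finsupp.single_apply, hiff]
  split_ifs <;> simp

/-- The diagonal element `∑ i, cell (u i) (u i)` is an order unit for the cone of sums of
hermitian squares. -/
theorem exists_add_smul_unit_mem_sosCone (hinv : Function.Involutive inv)
    (hcell : ∀ p q, cell q p = inv (cell p q)) (hu : ∀ p, ∃ i, cell p p = cell (u i) (u i))
    (T : C →₀ ℂ) :
    ∃ t : ℝ, ∃ S ∈ sosCone cell, ∀ p q,
      T (cell p q) + star (T (inv (cell p q))) +
        (t • ∑ i, Finsupp.single (cell (u i) (u i)) (1 : ℂ)) (cell p q) = S (cell p q) := by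
  classical
  set e : C →₀ ℂ := ∑ i, Finsupp.single (cell (u i) (u i)) 1 with he
  have hsub : ∀ p, e - Finsupp.single (cell p p) 1 ∈ sosCone cell := fun p => by
    obtain ⟨i, hi⟩ := hu p
    rw [hi, he, ← Finset.add_sum_erase _ _ (Finset.mem_univ i), add_sub_cancel_left]
    exact sum_mem fun j _ => single_mem_sosCone (u j)
  induction T using Finsupp.induction_linear with
  | zero => exact ⟨0, 0, zero_mem _, by simp⟩
  | add T₁ T₂ h₁ h₂ =>
    obtain ⟨t₁, S₁, hS₁, h₁⟩ := h₁
    obtain ⟨t₂, S₂, hS₂, h₂⟩ := h₂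
    refine ⟨t₁ + t₂, S₁ + S₂, add_mem hS₁ hS₂, fun p q => ?_⟩
    rw [Finsupp.add_apply S₁, ← h₁, ← h₂]
    simp only [Finsupp.add_apply, star_add, add_smul]
    ring
  | single c z =>
    by_cases hc : ∃ p q, cell p q = c
    · obtain ⟨p, q, rfl⟩ := hc
      refine ⟨1 + ‖z‖ ^ 2, gramForm cell (Finsupp.single p 1 + Finsupp.single q z)
        (Finsupp.single p 1 + Finsupp.single q z) + (e - Finsupp.single (cell p p) 1) +
        (‖z‖ ^ 2) • (e - Finsupp.single (cell q q) 1),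
        add_mem (add_mem (gramForm_mem_sosCone _) (hsub p))
          (smul_mem_sosCone (by positivity) (hsub q)), fun p' q' => ?_⟩
      have hz : star z * z = ((‖z‖ ^ 2 : ℝ) : ℂ) := by
        rw [Complex.star_def, Complex.conj_mul']; push_cast; rfl
      have hqq : Finsupp.single (cell q q) (star z * z) =
          (‖z‖ ^ 2) • Finsupp.single (cell q q) (1 : ℂ) := by
        rw [Finsupp.smul_single, hz, Complex.real_smul, mul_one]
      rw [star_single_apply_inv hinv, ← hcell]
      simp only [gramForm_add_left, gramForm_add_right, gramForm_single, hqq, star_one, one_mul,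
        mul_one, ← Finsupp.add_apply]
      congr 1
      module
    · refine ⟨0, 0, zero_mem _, fun p q => ?_⟩
      have h1 : c ≠ cell p q := fun h => hc ⟨p, q, h.symm⟩
      have h2 : c ≠ inv (cell p q) := fun h => hc ⟨q, p, by rw [hcell p q, h]⟩
      simp [h1, h2]

end SumOfSquares

section Separation

variable {P C : Type*} {cell : P → P → C} {inv : C → C} {ι : Type*} [Fintype ι] {u : ι → P}

theorem mem_sosCone_of_eq_on_cells {S T : C →₀ ℂ} (hS : S ∈ sosCone cell)
    (hT : ∀ c, T c ≠ 0 → ∃ p q, cell p q = c) (h : ∀ p q, T (cell p q) = S (cell p q)) :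
    T ∈ sosCone cell := by
  have : T = S := by
    ext c
    by_cases hc : ∃ p q, cell p q = c
    · obtain ⟨p, q, rfl⟩ := hc
      exact h p q
    · rw [apply_eq_zero_of_mem_sosCone hS fun p q hpq => hc ⟨p, q, hpq⟩]
      exact not_not.1 fun h0 => hc (hT c h0)
  rwa [this]

theorem sum_single_mem_sosCone (u : ι → P) :
    ∑ i, Finsupp.single (cell (u i) (u i)) (1 : ℂ) ∈ sosCone cell :=
  sum_mem fun i _ => single_mem_sosCone (u i)

theorem sum_single_diag_apply_inv (hinv : Function.Involutive inv)
    (hcell : ∀ p q, cell q p = inv (cell p q)) (c : C) :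
    star ((∑ i, Finsupp.single (cell (u i) (u i)) (1 : ℂ)) (inv c)) =
      (∑ i, Finsupp.single (cell (u i) (u i)) (1 : ℂ)) c := by
  simp only [Finsupp.finsetSum_apply, star_sum]
  refine Finset.sum_congr rfl fun i _ => ?_
  rw [star_single_apply_inv hinv, ← hcell, star_one]

/-- The cone used to separate `A` from the sums of hermitian squares: those `T` whose hermitian part
lies, up to subtracting a nonnegative multiple of `A`, in the cone of sums of squares. -/
noncomputable def separationCone (cell : P → P → C) (inv : C → C) (A : C →₀ ℂ) :
    PointedCone ℝ (C →₀ ℂ) where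
  carrier := {T | ∃ r : ℝ, 0 ≤ r ∧ ∃ S ∈ sosCone cell, ∀ p q,
    T (cell p q) + star (T (inv (cell p q))) + (r • A) (cell p q) = S (cell p q)}
  add_mem' := by
    rintro T₁ T₂ ⟨r₁, hr₁, S₁, hS₁, h₁⟩ ⟨r₂, hr₂, S₂, hS₂, h₂⟩
    refine ⟨r₁ + r₂, add_nonneg hr₁ hr₂, S₁ + S₂, add_mem hS₁ hS₂, fun p q => ?_⟩
    rw [Finsupp.add_apply S₁, ← h₁, ← h₂]
    simp only [Finsupp.add_apply, star_add, add_smul]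
    ring
  zero_mem' := ⟨0, le_rfl, 0, zero_mem _, by simp⟩
  smul_mem' := by
    rintro ⟨t, ht⟩ T ⟨r, hr, S, hS, h⟩
    refine ⟨t * r, mul_nonneg ht hr, t • S, smul_mem_sosCone ht hS, fun p q => ?_⟩
    change (t • T) (cell p q) + star ((t • T) (inv (cell p q))) + ((t * r) • A) (cell p q) =
      (t • S) (cell p q)
    rw [Finsupp.smul_apply t S, ← h]
    simp only [Finsupp.smul_apply, Complex.real_smul, star_mul', Complex.star_def,
      Complex.conj_ofReal]
    push_cast
    ring

theorem neg_unit_not_mem_sosCone (hinv : Function.Involutive inv)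
    (hcell : ∀ p q, cell q p = inv (cell p q)) (hu : ∀ p, ∃ i, cell p p = cell (u i) (u i))
    {A : C →₀ ℂ} (hA : ∀ c, A (inv c) = star (A c)) (hsupp : ∀ c, A c ≠ 0 → ∃ p q, cell p q = c)
    (hmem : A ∉ sosCone cell) :
    -∑ i, Finsupp.single (cell (u i) (u i)) (1 : ℂ) ∉ sosCone cell := by
  intro hneg
  set e : C →₀ ℂ := ∑ i, Finsupp.single (cell (u i) (u i)) 1 with he
  obtain ⟨t, S, hS, h⟩ := exists_add_smul_unit_mem_sosCone hinv hcell hu A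
  have hte : (-t) • e ∈ sosCone cell := by
    rcases le_total 0 t with ht | ht
    · rw [neg_smul, ← smul_neg]
      exact smul_mem_sosCone ht hneg
    · exact smul_mem_sosCone (neg_nonneg.2 ht) (sum_single_mem_sosCone u)
  refine hmem (mem_sosCone_of_eq_on_cells
    (smul_mem_sosCone (r := 1 / 2) (by norm_num) (add_mem hS hte)) hsupp fun p q => ?_)
  rw [Finsupp.smul_apply, Finsupp.add_apply, ← h, hA, star_star, ← he]
  simp only [Finsupp.smul_apply, Complex.real_smul]
  push_cast
  ring

theorem nonneg_of_smul_unit_mem_separationCone (hinv : Function.Involutive inv)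
    (hcell : ∀ p q, cell q p = inv (cell p q)) (hu : ∀ p, ∃ i, cell p p = cell (u i) (u i))
    {A : C →₀ ℂ} (hA : ∀ c, A (inv c) = star (A c)) (hsupp : ∀ c, A c ≠ 0 → ∃ p q, cell p q = c)
    (hmem : A ∉ sosCone cell) {t : ℝ}
    (ht : t • ∑ i, Finsupp.single (cell (u i) (u i)) (1 : ℂ) ∈ separationCone cell inv A) :
    0 ≤ t := by
  by_contra! hneg
  have hunit := neg_unit_not_mem_sosCone hinv hcell hu hA hsupp hmem
  have hsym := sum_single_diag_apply_inv (u := u) hinv hcell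
  have heS := sum_single_mem_sosCone (cell := cell) u
  set e : C →₀ ℂ := ∑ i, Finsupp.single (cell (u i) (u i)) 1 with he
  obtain ⟨r, hr, S, hS, h⟩ := ht
  have h' : ∀ p q, (2 * t : ℂ) * e (cell p q) + r * A (cell p q) = S (cell p q) := fun p q => by
    rw [← h]
    simp only [Finsupp.smul_apply, Complex.real_smul, star_mul', Complex.star_def,
      Complex.conj_ofReal]
    rw [← Complex.star_def, hsym]
    ring
  rcases hr.eq_or_lt with rfl | hr
  · refine hunit (mem_sosCone_of_eq_on_cells
      (smul_mem_sosCone (r := (-(2 * t))⁻¹) (by rw [inv_nonneg]; linarith) hS) (fun c hc => ?_)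
      fun p q => ?_)
    · by_contra hne
      refine hc ?_
      rw [Finsupp.neg_apply, apply_eq_zero_of_mem_sosCone heS fun p q hpq => hne ⟨p, q, hpq⟩,
        neg_zero]
    · rw [Finsupp.smul_apply, ← h', Finsupp.neg_apply, Complex.real_smul]
      have : (t : ℂ) ≠ 0 := by exact_mod_cast hneg.ne
      push_cast
      field_simp
      ring
  · refine hmem (mem_sosCone_of_eq_on_cells
      (smul_mem_sosCone (r := r⁻¹) (by positivity)
        (add_mem hS (smul_mem_sosCone (r := -(2 * t)) (by linarith) heS))) hsupp fun p q => ?_)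
    rw [Finsupp.smul_apply, Finsupp.add_apply, ← h', Finsupp.smul_apply, Complex.real_smul,
      Complex.real_smul]
    have : (r : ℂ) ≠ 0 := by exact_mod_cast hr.ne'
    push_cast
    field_simp
    ring

/-- A hermitian element which is not a sum of hermitian squares is separated from the sums of
squares by a linear functional, normalized at the order unit. -/
theorem exists_separating_functional (hinv : Function.Involutive inv)
    (hcell : ∀ p q, cell q p = inv (cell p q)) (hu : ∀ p, ∃ i, cell p p = cell (u i) (u i))
    {A : C →₀ ℂ} (hA : ∀ c, A (inv c) = star (A c)) (hsupp : ∀ c, A c ≠ 0 → ∃ p q, cell p q = c)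
    (hmem : A ∉ sosCone cell) :
    ∃ φ : (C →₀ ℂ) →ₗ[ℝ] ℝ, (∀ T ∈ separationCone cell inv A, 0 ≤ φ T) ∧
      φ (∑ i, Finsupp.single (cell (u i) (u i)) 1) = 1 := by
  have hnn := fun t => nonneg_of_smul_unit_mem_separationCone (t := t) hinv hcell hu hA hsupp hmem
  have hunit := neg_unit_not_mem_sosCone hinv hcell hu hA hsupp hmem
  have hsym := sum_single_diag_apply_inv (u := u) hinv hcell
  have hord := exists_add_smul_unit_mem_sosCone hinv hcell hu
  set e : C →₀ ℂ := ∑ i, Finsupp.single (cell (u i) (u i)) 1 with he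
  have he0 : e ≠ 0 := fun h0 => hunit (by rw [h0, neg_zero]; exact zero_mem _)
  have hnonneg : ∀ x : (LinearPMap.mkSpanSingleton (σ := RingHom.id ℝ) e (1 : ℝ) he0).domain,
      (x : C →₀ ℂ) ∈ separationCone cell inv A →
        0 ≤ LinearPMap.mkSpanSingleton (σ := RingHom.id ℝ) e (1 : ℝ) he0 x := by
    rintro ⟨x, hx⟩ hxs
    obtain ⟨t, rfl⟩ := Submodule.mem_span_singleton.1 hx
    have := LinearPMap.mkSpanSingleton'_apply (σ := RingHom.id ℝ) e (1 : ℝ)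
      (fun c hc => by simp [(smul_eq_zero.1 hc).resolve_right he0]) t hx
    refine le_of_le_of_eq (hnn t hxs) ?_
    symm
    refine Eq.trans this ?_
    simp
  have hdense : ∀ T : C →₀ ℂ,
      ∃ x : (LinearPMap.mkSpanSingleton (σ := RingHom.id ℝ) e (1 : ℝ) he0).domain,
        (x : C →₀ ℂ) + T ∈ separationCone cell inv A := by
    intro T
    obtain ⟨t, S, hS, h⟩ := hord T
    refine ⟨⟨(t / 2) • e, Submodule.smul_mem _ _ (Submodule.mem_span_singleton_self e)⟩,
      0, le_rfl, S, hS, fun p q => ?_⟩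
    rw [← h]
    simp only [Finsupp.add_apply, Finsupp.smul_apply, Complex.real_smul, star_add, star_mul',
      Complex.star_def, Complex.conj_ofReal]
    rw [← Complex.star_def, hsym]
    push_cast
    ring
  obtain ⟨φ, hφ, hφ0⟩ := riesz_extension _ _ hnonneg hdense
  refine ⟨φ, hφ0, ?_⟩
  have := hφ ⟨e, Submodule.mem_span_singleton_self e⟩
  rw [this]
  exact LinearPMap.mkSpanSingleton_apply ℝ ℝ he0 1


theorem gramForm_apply_inv (hinv : Function.Involutive inv)
    (hcell : ∀ p q, cell q p = inv (cell p q)) (b : P →₀ ℂ) (c : C) :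
    star (gramForm cell b b (inv c)) = gramForm cell b b c := by
  simp only [gramForm, Finsupp.sum, Finsupp.finsetSum_apply, star_sum]
  rw [Finset.sum_comm]
  refine Finset.sum_congr rfl fun p _ => Finset.sum_congr rfl fun q _ => ?_
  rw [star_single_apply_inv hinv, ← hcell, star_mul', star_star, mul_comm]

theorem apply_eq_sum_of_real_linear (φ : (C →₀ ℂ) →ₗ[ℝ] ℝ) (T : C →₀ ℂ) :
    φ T = (T.sum fun c z => z * ((φ (Finsupp.single c 1) : ℂ) -
      Complex.I * φ (Finsupp.single c Complex.I))).re := by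
  induction T using Finsupp.induction_linear with
  | zero => simp
  | add S T hS hT =>
    rw [map_add, hS, hT, Finsupp.sum_add_index' (by simp) (by intros; ring), Complex.add_re]
  | single c z =>
    have hz : Finsupp.single c z =
        z.re • Finsupp.single c (1 : ℂ) + z.im • Finsupp.single c Complex.I := by
      rw [Finsupp.smul_single, Finsupp.smul_single, ← Finsupp.single_add]
      congr 1
      simp [Complex.re_add_im]
    rw [Finsupp.sum_single_index (by simp)]
    conv_lhs => rw [hz]
    rw [map_add, map_smul, map_smul]
    simp

/-- A hermitian element which is not a sum of hermitian squares is separated from the sums of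
squares by a positive semidefinite kernel. -/
theorem exists_posSemidef_separating (hinv : Function.Involutive inv)
    (hcell : ∀ p q, cell q p = inv (cell p q)) (hu : ∀ p, ∃ i, cell p p = cell (u i) (u i))
    {A : C →₀ ℂ} (hA : ∀ c, A (inv c) = star (A c)) (hsupp : ∀ c, A c ≠ 0 → ∃ p q, cell p q = c)
    (hmem : A ∉ sosCone cell) :
    ∃ f : C → ℂ, Matrix.PosSemidef (fun p q => f (cell p q) : Matrix P P ℂ) ∧
      (A.sum fun c z => z * f c).re ≤ 0 ∧ (∑ i, f (cell (u i) (u i))).re = 1 := by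
  obtain ⟨φ, hφ, hφ1⟩ := exists_separating_functional hinv hcell hu hA hsupp hmem
  set f : C → ℂ := fun c => (φ (Finsupp.single c 1) : ℂ) -
    Complex.I * φ (Finsupp.single c Complex.I)
  have hφf : ∀ T : C →₀ ℂ, φ T = (T.sum fun c z => z * f c).re := apply_eq_sum_of_real_linear φ
  have hsingle : ∀ c z, φ (Finsupp.single c z) = (z * f c).re := fun c z => by
    rw [hφf, Finsupp.sum_single_index (by simp)]
  have hzero : ∀ c z, φ (Finsupp.single (inv c) (star z)) = φ (Finsupp.single c z) := fun c z => by
    have h1 : Finsupp.single (inv c) (star z) - Finsupp.single c z ∈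
        separationCone cell inv A := by
      refine ⟨0, le_rfl, 0, zero_mem _, fun p q => ?_⟩
      simp only [Finsupp.sub_apply, star_sub, star_single_apply_inv hinv, star_star, hinv c]
      simp
    have h2 : Finsupp.single c z - Finsupp.single (inv c) (star z) ∈
        separationCone cell inv A := by
      refine ⟨0, le_rfl, 0, zero_mem _, fun p q => ?_⟩
      simp only [Finsupp.sub_apply, star_sub, star_single_apply_inv hinv, star_star, hinv c]
      simp
    have h1 := hφ _ h1
    have h2 := hφ _ h2
    rw [map_sub] at h1 h2
    linarith
  have hherm : ∀ c, star (f (inv c)) = f c := fun c => by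
    have h1 := hzero c 1
    have h2 := hzero c Complex.I
    rw [hsingle, hsingle] at h1 h2
    apply Complex.ext
    · simpa using h1
    · simpa [neg_eq_iff_eq_neg] using h2
  refine ⟨f, ⟨?_, fun b => ?_⟩, ?_, ?_⟩
  · ext p q
    change star (f (cell q p)) = f (cell p q)
    rw [hcell p q, hherm]
  · rw [Complex.nonneg_iff]
    have hgram : (b.sum fun p z => b.sum fun q w => star z * f (cell p q) * w) =
        (gramForm cell b b).sum fun c z => z * f c := by
      simp only [gramForm]
      rw [Finsupp.sum_sum_index (by simp) (by intros; ring)]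
      refine Finsupp.sum_congr fun p _ => ?_
      rw [Finsupp.sum_sum_index (by simp) (by intros; ring)]
      refine Finsupp.sum_congr fun q _ => ?_
      rw [Finsupp.sum_single_index (by simp)]
      ring
    constructor
    · rw [hgram, ← hφf]
      refine hφ _ ⟨0, le_rfl, (2 : ℝ) • gramForm cell b b,
        smul_mem_sosCone zero_le_two (gramForm_mem_sosCone b), fun p q => ?_⟩
      rw [gramForm_apply_inv hinv hcell]
      simp [two_mul]
    · have : star (b.sum fun p z => b.sum fun q w => star z * f (cell p q) * w) =
          b.sum fun p z => b.sum fun q w => star z * f (cell p q) * w := by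
        simp only [Finsupp.sum, star_sum]
        rw [Finset.sum_comm]
        refine Finset.sum_congr rfl fun p _ => Finset.sum_congr rfl fun q _ => ?_
        rw [hcell p q, star_mul', star_mul', hherm, star_star]
        ring
      exact (Complex.conj_eq_iff_im.1 this).symm
  · rw [← hφf]
    have : -A ∈ separationCone cell inv A := by
      refine ⟨2, zero_le_two, 0, zero_mem _, fun p q => ?_⟩
      simp only [Finsupp.neg_apply, hA, star_neg, star_star, Finsupp.smul_apply]
      simp only [Complex.real_smul, Finsupp.coe_zero, Pi.zero_apply]
      push_cast
      ring
    have := hφ _ this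
    rw [map_neg] at this
    linarith
  · rw [map_sum] at hφ1
    rw [← hφ1, Complex.re_sum]
    refine Finset.sum_congr rfl fun i _ => ?_
    rw [hsingle, one_mul]

end Separation

section Extraction

theorem exists_sum_gramForm_of_mem_sosCone {P C : Type*} {cell : P → P → C} {S : C →₀ ℂ}
    (hS : S ∈ sosCone cell) :
    ∃ (n : ℕ) (b : Fin (n + 1) → P →₀ ℂ), S = ∑ k, gramForm cell (b k) (b k) := by
  obtain ⟨l, hl, rfl⟩ := AddSubmonoid.exists_list_of_mem_closure hS
  choose! b hb using hl
  refine ⟨l.length, Fin.cons 0 fun k => b l[k], ?_⟩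
  rw [Fin.sum_univ_succ]
  simp only [Fin.cons_zero, Fin.cons_succ]
  have hb' : ∀ k : Fin l.length, gramForm cell (b l[k]) (b l[k]) = l[k] := fun k =>
    hb _ (List.getElem_mem _)
  have h0 : gramForm cell 0 0 = 0 := Finsupp.sum_zero_index
  rw [h0, zero_add, Finset.sum_congr rfl fun k _ => hb' k]
  simp

variable {G Y : Type*} [Group Y] {K : ℕ} {W : Set G}

open Classical in
/-- The coefficients of a family indexed by `Y × (W × Fin K)`, translated by `s` in `Y` and extended
by zero. -/
noncomputable def translateCoeff (s : Y) (b : Y × (W × Fin K) →₀ ℂ) (β : G × Y) (i : Fin K) : ℂ :=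
  if h : β.1 ∈ W then b (s⁻¹ * β.2, (⟨β.1, h⟩, i)) else 0

theorem sum_eq_sum_translateCoeff {N : Type*} [AddCommMonoid N] {s : Y}
    {b : Y × (W × Fin K) →₀ ℂ} {D : Finset (G × Y)}
    (hD : ∀ p ∈ b.support, ((p.2.1 : G), s * p.1) ∈ D) (ψ : G × Y → Fin K → ℂ → N)
    (hψ : ∀ β i, ψ β i 0 = 0) :
    (b.sum fun p z => ψ ((p.2.1 : G), s * p.1) p.2.2 z) =
      ∑ β ∈ D, ∑ i, ψ β i (translateCoeff s b β i) := by
  rw [← Finset.sum_product', Finsupp.sum]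
  refine Finset.sum_of_injOn (fun p => (((p.2.1 : G), s * p.1), p.2.2)) ?_ ?_ ?_ ?_
  · rintro ⟨η, ⟨u, hu⟩, i⟩ - ⟨θ, ⟨v, hv⟩, j⟩ - h
    simp only [Prod.mk.injEq, mul_right_inj] at h
    obtain ⟨⟨rfl, rfl⟩, rfl⟩ := h
    rfl
  · intro p hp
    simpa using hD p (by simpa using hp)
  · rintro ⟨⟨u, η⟩, i⟩ - hni
    dsimp only
    by_cases hu : u ∈ W
    · have : b (s⁻¹ * η, (⟨u, hu⟩, i)) = 0 := by
        by_contra hne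
        exact hni ⟨_, by simpa using hne, by simp⟩
      rw [translateCoeff, dif_pos hu, this, hψ]
    · rw [translateCoeff, dif_neg hu, hψ]
  · rintro ⟨η, ⟨u, hu⟩, i⟩ -
    simp [translateCoeff, hu]

variable [Group G]

/-- The cell of the pair `p, q` records the group element `p⁻¹ * q` and the matrix position. -/
def trigCell (W : Set G) (p q : Y × (W × Fin K)) : (G × Y) × Fin K × Fin K :=
  (((p.2.1 : G)⁻¹ * q.2.1, p.1⁻¹ * q.1), p.2.2, q.2.2)

open Classical in
theorem gramForm_trigCell_apply {s : Y} {b : Y × (W × Fin K) →₀ ℂ} {D : Finset (G × Y)}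
    (hD : ∀ p ∈ b.support, ((p.2.1 : G), s * p.1) ∈ D) (α : G × Y) (i j : Fin K) :
    gramForm (trigCell W) b b (α, i, j) = ∑ β ∈ D, ∑ γ ∈ D,
      if β⁻¹ * γ = α then star (translateCoeff s b β i) * translateCoeff s b γ j else 0 := by
  have hcell : ∀ p q : Y × (W × Fin K), trigCell W p q =
      (((p.2.1 : G), s * p.1)⁻¹ * ((q.2.1 : G), s * q.1), p.2.2, q.2.2) := fun p q => by
    simp [trigCell, mul_assoc]
  have h1 : gramForm (trigCell W) b b =
      ∑ β ∈ D, ∑ i', ∑ γ ∈ D, ∑ j', Finsupp.single (β⁻¹ * γ, i', j')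
        (star (translateCoeff s b β i') * translateCoeff s b γ j') := by
    simp only [gramForm, hcell]
    rw [← sum_eq_sum_translateCoeff hD (fun β i' z => ∑ γ ∈ D, ∑ j',
      Finsupp.single (β⁻¹ * γ, i', j') (star z * translateCoeff s b γ j')) (by simp)]
    refine Finsupp.sum_congr fun p _ => ?_
    exact sum_eq_sum_translateCoeff hD (fun γ j' w => Finsupp.single
      (((p.2.1 : G), s * p.1)⁻¹ * γ, p.2.2, j') (star (b p) * w)) (by simp)
  rw [h1]
  simp only [Finsupp.finsetSum_apply, Finsupp.single_apply, Prod.mk.injEq]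
  refine Finset.sum_congr rfl fun β _ => ?_
  rw [Finset.sum_comm]
  refine Finset.sum_congr rfl fun γ _ => ?_
  by_cases h : β⁻¹ * γ = α
  · simp only [h, true_and, if_true]
    rw [Finset.sum_eq_single i (fun i' _ hi' => by simp [hi']) (by simp)]
    simp
  · simp [h]

theorem exists_mul_mem_Yle {h : ℕ} {y : Fin h → Y}
    (hY : ∀ η : Y, ∃ a b : List (Fin h), ((a.map y).prod)⁻¹ * (b.map y).prod = η)
    (T : Finset Y) : ∃ (s : Y) (M : ℕ), 0 < M ∧ ∀ η ∈ T, s * η ∈ Yle y M := by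
  classical
  induction T using Finset.induction_on with
  | empty => exact ⟨1, 1, one_pos, by simp⟩
  | insert η T _ ih =>
    obtain ⟨s, M, hM, hs⟩ := ih
    obtain ⟨a, b, hab⟩ := hY (s * η)
    refine ⟨(a.map y).prod * s, b.length + (a.length + M), by omega, fun θ hθ => ?_⟩
    rcases Finset.mem_insert.1 hθ with rfl | hθ
    · exact ⟨b, by omega, by rw [mul_assoc, ← hab, mul_inv_cancel_left]⟩
    · obtain ⟨l, hl, hlθ⟩ := hs θ hθ
      exact ⟨a ++ l, by simp; omega, by simp [hlθ, mul_assoc]⟩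

theorem finite_Yle {h : ℕ} (y : Fin h → Y) (M : ℕ) : (Yle y M).Finite :=
  Set.Finite.image (fun l : List (Fin h) => (l.map y).prod) (List.finite_length_le (Fin h) M)

theorem ShortlexLE.length_le {n : ℕ} {a b : List (Fin n)} (h : ShortlexLE a b) :
    a.length ≤ b.length := by
  rcases h with (h | h) | rfl
  · exact h.le
  · exact h.1.le
  · exact le_rfl

theorem ShortlexLE.of_length_lt {n : ℕ} {a b : List (Fin n)} (h : a.length < b.length) :
    ShortlexLE a b :=
  Or.inl (Or.inl h)

theorem shortlexLE_nil {n : ℕ} (w : List (Fin n)) : ShortlexLE [] w := by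
  rcases w with _ | ⟨a, w⟩
  · exact Or.inr rfl
  · exact ShortlexLE.of_length_lt (by simp)

theorem ShortlexLE.of_cons {n : ℕ} {a : Fin n} {l w : List (Fin n)} (h : ShortlexLE (a :: l) w) :
    ShortlexLE l w :=
  ShortlexLE.of_length_lt (Nat.lt_of_succ_le h.length_le)

theorem finite_WleF {g : ℕ} (w : List (Fin g)) : (WleF w).Finite :=
  ((List.finite_length_le (Fin g) w.length).subset fun _ hl => ShortlexLE.length_le hl).image wordF

theorem finite_HerYle {h : ℕ} (y : Fin h → Y) (M : ℕ) : (HerYle y M).Finite :=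
  Set.Finite.image2 (fun a b => a⁻¹ * b) (finite_Yle y M) (finite_Yle y M)

theorem finite_HerWleF {g : ℕ} (w : List (Fin g)) : (HerWleF w).Finite :=
  Set.Finite.image2 (fun u v => u⁻¹ * v) (finite_WleF w) (finite_WleF w)

/-- A sum of hermitian squares in the cone factors as `Bᴴ * B` with an analytic polynomial `B`. -/
theorem exists_factorization_of_mem_sosCone {h : ℕ} {y : Fin h → Y}
    (hY : ∀ η : Y, ∃ a b : List (Fin h), ((a.map y).prod)⁻¹ * (b.map y).prod = η)
    (hW : W.Finite) {A : G × Y → Matrix (Fin K) (Fin K) ℂ} {S : (G × Y) × Fin K × Fin K →₀ ℂ}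
    (hS : S ∈ sosCone (trigCell W)) (hAS : ∀ α i j, A α i j = S (α, i, j)) :
    ∃ K' M' : ℕ, 0 < K' ∧ 0 < M' ∧ ∃ B : G × Y → Matrix (Fin K') (Fin K) ℂ, ∀ α,
      A α = ∑ᶠ β ∈ W ×ˢ Yle y M', ∑ᶠ γ ∈ {γ : G × Y | γ ∈ W ×ˢ Yle y M' ∧ β⁻¹ * γ = α},
        (B β)ᴴ * B γ := by
  classical
  obtain ⟨n, b, rfl⟩ := exists_sum_gramForm_of_mem_sosCone hS
  obtain ⟨s, M', hM', hs⟩ := exists_mul_mem_Yle hY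
    (Finset.univ.biUnion fun k => (b k).support.image Prod.fst)
  have hX : (W ×ˢ Yle y M').Finite := hW.prod (finite_Yle y M')
  have hD : ∀ k, ∀ p ∈ (b k).support, ((p.2.1 : G), s * p.1) ∈ hX.toFinset := fun k p hp => by
    rw [Set.Finite.mem_toFinset]
    refine ⟨p.2.1.2, hs _ (Finset.mem_biUnion.2 ⟨k, Finset.mem_univ k, ?_⟩)⟩
    exact Finset.mem_image_of_mem _ hp
  refine ⟨n + 1, M', n.succ_pos, hM', fun β => Matrix.of fun k i => translateCoeff s (b k) β i,
    fun α => ?_⟩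
  have hinner : ∀ (β : G × Y) (Φ : G × Y → Matrix (Fin K) (Fin K) ℂ),
      ∑ᶠ γ ∈ {γ : G × Y | γ ∈ W ×ˢ Yle y M' ∧ β⁻¹ * γ = α}, Φ γ =
        ∑ γ ∈ hX.toFinset, if β⁻¹ * γ = α then Φ γ else 0 := fun β Φ => by
    rw [← Finset.sum_filter, finsum_mem_eq_finite_toFinset_sum _ (hX.subset fun γ hγ => hγ.1)]
    congr 1
    ext γ
    simp
  simp only [hinner]
  rw [finsum_mem_eq_finite_toFinset_sum _ hX]
  ext i j
  rw [hAS, Finsupp.finsetSum_apply, Finset.sum_congr rfl fun k _ =>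
    gramForm_trigCell_apply (hD k) α i j, Finset.sum_comm, Matrix.sum_apply]
  refine Finset.sum_congr rfl fun β _ => ?_
  rw [Finset.sum_comm, Matrix.sum_apply]
  refine Finset.sum_congr rfl fun γ _ => ?_
  split_ifs
  · simp [Matrix.mul_apply]
  · simp

end Extraction

end FejerRiesz

/-- Noncommutative Fejér–Riesz theorem for the free semigroup `⟨x⟩_g` times `𝔜`. -/
theorem stmt0
    (g h K M : ℕ) (hg : 0 < g) (hh : 0 < h) (hK : 0 < K) (hM : 0 < M)
    (Y : Type) [Group Y] (y : Fin h → Y)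
    (hY : ∀ η : Y, ∃ a b : List (Fin h), ((a.map y).prod)⁻¹ * (b.map y).prod = η)
    (w : List (Fin g))
    (A : FreeGroup (Fin g) × Y → Matrix (Fin K) (Fin K) ℂ)
    (hAsupp : ∀ α, A α ≠ 0 → α ∈ (HerWleF w) ×ˢ (HerYle y M))
    (hpos : ∀ (F : Type) [NormedAddCommGroup F] [InnerProductSpace ℂ F]
        [CompleteSpace F] [TopologicalSpace.SeparableSpace F]
        (π : FreeGroup (Fin g) × Y →* (F ≃ₗᵢ[ℂ] F)) (ξ : Fin K → F), ξ ≠ 0 →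
        0 < (∑ᶠ α ∈ (HerWleF w) ×ˢ (HerYle y M),
              ∑ i : Fin K, ∑ j : Fin K, A α i j * ⟪ξ i, π α (ξ j)⟫).re ∧
        (∑ᶠ α ∈ (HerWleF w) ×ˢ (HerYle y M),
              ∑ i : Fin K, ∑ j : Fin K, A α i j * ⟪ξ i, π α (ξ j)⟫).im = 0) :
    ∃ K' M' : ℕ, 0 < K' ∧ 0 < M' ∧
      ∃ B : FreeGroup (Fin g) × Y → Matrix (Fin K') (Fin K) ℂ,
        ∀ α : FreeGroup (Fin g) × Y,
          A α = ∑ᶠ β ∈ (WleF w) ×ˢ (Yle y M'),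
                  ∑ᶠ γ ∈ {γ : FreeGroup (Fin g) × Y |
                            γ ∈ (WleF w) ×ˢ (Yle y M') ∧ β⁻¹ * γ = α},
                    (B β)ᴴ * B γ := by
  classical
  have : Countable Y := by
    have hsurj : Function.Surjective fun p : List (Fin h) × List (Fin h) =>
        ((p.1.map y).prod)⁻¹ * (p.2.map y).prod := fun η => by
      obtain ⟨a, b, hab⟩ := hY η
      exact ⟨(a, b), hab⟩
    exact hsurj.countable
  have hfin := (finite_HerWleF w).prod (finite_HerYle y M)
  have hA0 : ∀ α ∉ hfin.toFinset, A α = 0 := fun α hα => by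
    by_contra hne
    exact hα (hfin.mem_toFinset.2 (hAsupp α hne))
  have hherm : ∀ α, A α⁻¹ = (A α)ᴴ := by
    refine apply_inv_eq_conjTranspose_of_im_eq_zero hfin.toFinset A hA0 fun F _ _ _ _ π ξ => ?_
    rcases eq_or_ne ξ 0 with rfl | hξ
    · simp
    · rw [← finsum_mem_eq_finite_toFinset_sum _ hfin]
      exact (hpos F π ξ hξ).2
  set T : (FreeGroup (Fin g) × Y) × Fin K × Fin K →₀ ℂ :=
    Finsupp.onFinset (hfin.toFinset ×ˢ Finset.univ) (fun c => A c.1 c.2.1 c.2.2) (fun c hc => by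
      rw [Finset.mem_product]
      refine ⟨?_, Finset.mem_univ _⟩
      by_contra hne
      exact hc (by rw [hA0 _ hne]; rfl)) with hT
  have hTA : ∀ α i j, A α i j = T (α, i, j) := fun α i j => rfl
  have h1W : (1 : FreeGroup (Fin g)) ∈ WleF w := ⟨[], shortlexLE_nil w, rfl⟩
  refine exists_factorization_of_mem_sosCone hY (finite_WleF w) (S := T) ?_ hTA
  by_contra hmem
  obtain ⟨f, hpsd, hle, hone⟩ := exists_posSemidef_separating (cell := trigCell (WleF w))
    (inv := fun c => (c.1⁻¹, c.2.2, c.2.1))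
    (u := fun i : Fin K => ((1 : Y), ((⟨1, h1W⟩ : WleF w), i)))
    (fun c => by simp) (fun p q => by simp [trigCell])
    (fun p => ⟨p.2.2, by simp [trigCell]⟩)
    (fun c => by rw [← hTA, hherm]; rfl)
    (fun c hc => by
      obtain ⟨⟨u, hu, v, hv, huv⟩, -⟩ := hAsupp c.1 fun h0 => hc (by
        change A c.1 c.2.1 c.2.2 = 0
        rw [h0]; rfl)
      exact ⟨(1, (⟨u, hu⟩, c.2.1)), (c.1.2, (⟨v, hv⟩, c.2.2)), by simp [trigCell, huv]⟩) hmem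
  obtain ⟨F, _, _, _, _, π, ξ, hξ⟩ := exists_rep_of_posSemidef (L := {l | ShortlexLE l w})
    (shortlexLE_nil w) (fun a l => ShortlexLE.of_cons) (fun α => Matrix.of fun i j => f (α, i, j))
    hpsd
  have hξ0 : ξ ≠ 0 := by
    rintro rfl
    have hzero : ∀ i, f (1, i, i) = 0 := fun i => by
      have := hξ 1 h1W 1 h1W 1 i i
      simpa [← Prod.one_eq_mk] using this.symm
    simp [trigCell, ← Prod.one_eq_mk, hzero] at hone
  refine (hpos F π ξ hξ0).1.not_ge (le_of_eq_of_le ?_ hle)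
  rw [finsum_mem_eq_finite_toFinset_sum _ hfin, hT, Finsupp.onFinset_sum _ (by simp),
    Finset.sum_product]
  congr 1
  refine Finset.sum_congr rfl fun α hα => ?_
  rw [← Finset.univ_product_univ, Finset.sum_product]
  refine Finset.sum_congr rfl fun i _ => Finset.sum_congr rfl fun j _ => ?_
  obtain ⟨⟨u, hu, v, hv, huv⟩, -⟩ := hfin.mem_toFinset.1 hα
  have := hξ u hu v hv α.2 i j
  rw [huv] at this
  rw [this]
  rfl
end

section
/- Let w ∈ Z₂^{*g}, let E be a complex Hilbert space, and let A assign a bounded operator A_u ∈ B(E) to each u ∈ Her W_{≤w}. If A(π) ⪰ 0 for every unitary representation π of Z₂^{*g} on a separable complex Hilbert space, then there exist a complex Hilbert space E′ and bounded operators B_v : E → E′ for v ∈ W_{≤w} such that for every α ∈ Her W_{≤w}, A_α equals the sum of B_u* B_v over all pairs u, v ∈ W_{≤w} with u⁻¹v = α. -/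
open scoped ComplexInnerProductSpace

/-- The relations `x_i² = e` presenting the free product of `g` copies of `ℤ/2`. -/
def z2Rels (g : ℕ) : Set (FreeGroup (Fin g)) :=
  {r | ∃ i : Fin g, r = FreeGroup.of i * FreeGroup.of i}

/-- The free product `ℤ₂^{*g}` of `g` copies of the cyclic group of order two. -/
abbrev Z2Star (g : ℕ) := PresentedGroup (z2Rels g)

/-- The canonical generators of `ℤ₂^{*g}`. -/
def z2of {g : ℕ} (i : Fin g) : Z2Star g := PresentedGroup.of (rels := z2Rels g) i

/-- The element of `ℤ₂^{*g}` given by a word in the generators. -/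
def wordZ {g : ℕ} (l : List (Fin g)) : Z2Star g := (l.map z2of).prod

/-- The shortlex order on `ℤ₂^{*g}`, via reduced words. -/
def Z2ShortlexLE {g : ℕ} (a b : Z2Star g) : Prop :=
  ∃ la lb : List (Fin g), List.Chain' (· ≠ ·) la ∧ List.Chain' (· ≠ ·) lb ∧
    wordZ la = a ∧ wordZ lb = b ∧ ShortlexLE la lb

/-- `W_{≤ w}` in `ℤ₂^{*g}`. -/
def WleZ {g : ℕ} (w : Z2Star g) : Set (Z2Star g) := {v | Z2ShortlexLE v w}

/-- `Her W_{≤ w} = {u⁻¹ v : u, v ∈ W_{≤ w}}` in `ℤ₂^{*g}`. -/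
def HerWleZ {g : ℕ} (w : Z2Star g) : Set (Z2Star g) :=
  {α | ∃ u ∈ WleZ w, ∃ v ∈ WleZ w, u⁻¹ * v = α}

/-- A bundled complex Hilbert space. -/
structure HilbertC : Type 1 where
  carrier : Type
  [nacg : NormedAddCommGroup carrier]
  [ips : InnerProductSpace ℂ carrier]
  [complete : CompleteSpace carrier]

attribute [instance] HilbertC.nacg HilbertC.ips HilbertC.complete

/-- Left multiplication by a generator on words: cancel the first letter or prepend a new one. -/
def toggleHead {n : ℕ} (i : Fin n) : List (Fin n) → List (Fin n)
  | [] => [i]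
  | j :: t => if j = i then t else i :: j :: t

theorem isChain_toggleHead {n : ℕ} (i : Fin n) {l : List (Fin n)} (hl : l.IsChain (· ≠ ·)) :
    (toggleHead i l).IsChain (· ≠ ·) := by
  cases l with
  | nil => simp [toggleHead]
  | cons j t =>
    by_cases h : j = i
    · simpa [toggleHead, h] using hl.tail
    · simp only [toggleHead, h, if_false]
      exact List.isChain_cons_cons.2 ⟨Ne.symm h, hl⟩

theorem toggleHead_of_isChain_cons {n : ℕ} {i : Fin n} {l : List (Fin n)}
    (hl : (i :: l).IsChain (· ≠ ·)) : toggleHead i l = i :: l := by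
  cases l with
  | nil => rfl
  | cons j t =>
    have := (List.isChain_cons_cons.1 hl).1
    simp [toggleHead, Ne.symm this]

theorem toggleHead_toggleHead {n : ℕ} (i : Fin n) {l : List (Fin n)} (hl : l.IsChain (· ≠ ·)) :
    toggleHead i (toggleHead i l) = l := by
  cases l with
  | nil => simp [toggleHead]
  | cons j t =>
    by_cases h : j = i
    · subst h
      simpa [toggleHead] using toggleHead_of_isChain_cons hl
    · simp [toggleHead, h]

/-- The involution of the set of reduced words induced by a generator. -/
def togglePerm {n : ℕ} (i : Fin n) : Equiv.Perm {l : List (Fin n) // l.IsChain (· ≠ ·)} where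
  toFun l := ⟨toggleHead i l, isChain_toggleHead i l.2⟩
  invFun l := ⟨toggleHead i l, isChain_toggleHead i l.2⟩
  left_inv l := Subtype.ext (toggleHead_toggleHead i l.2)
  right_inv l := Subtype.ext (toggleHead_toggleHead i l.2)

/-- A homomorphism out of `ℤ₂^{*g}` given by a family of involutions. -/
theorem exists_hom_z2of {g : ℕ} {H : Type*} [Group H] (U : Fin g → H) (hU : ∀ i, U i * U i = 1) :
    ∃ φ : Z2Star g →* H, ∀ i, φ (z2of i) = U i := by
  have h : ∀ r ∈ z2Rels g, FreeGroup.lift U r = 1 := by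
    rintro r ⟨i, rfl⟩
    simp [hU]
  exact ⟨PresentedGroup.toGroup h, fun i => PresentedGroup.toGroup.of h⟩

theorem z2of_mul_self {g : ℕ} (i : Fin g) : z2of i * z2of i = 1 := by
  have : (PresentedGroup.mk (z2Rels g)) (FreeGroup.of i * FreeGroup.of i) = 1 :=
    PresentedGroup.one_of_mem ⟨i, rfl⟩
  rwa [map_mul] at this

theorem z2of_inv {g : ℕ} (i : Fin g) : (z2of i)⁻¹ = z2of i :=
  inv_eq_of_mul_eq_one_left (z2of_mul_self i)

@[simp] theorem wordZ_nil {g : ℕ} : wordZ ([] : List (Fin g)) = 1 := rfl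

@[simp] theorem wordZ_cons {g : ℕ} (i : Fin g) (l : List (Fin g)) :
    wordZ (i :: l) = z2of i * wordZ l := by simp [wordZ]

/-- Reduced words representing the same element are equal. -/
theorem wordZ_injOn {g : ℕ} : Set.InjOn (wordZ (g := g)) {l | l.IsChain (· ≠ ·)} := by
  obtain ⟨φ, hφ⟩ := exists_hom_z2of (togglePerm (n := g)) fun i => by
    ext1 l
    exact (togglePerm i).left_inv l
  have key : ∀ l : List (Fin g), l.IsChain (· ≠ ·) → (φ (wordZ l) ⟨[], by simp⟩).1 = l := by
    intro l hl
    induction l with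
    | nil => simp
    | cons i t ih =>
      rw [wordZ_cons, map_mul, hφ, Equiv.Perm.mul_apply]
      change toggleHead i _ = _
      rw [ih hl.tail, toggleHead_of_isChain_cons hl]
  intro l hl l' hl' h
  rw [← key l hl, ← key l' hl', h]

theorem WleZ_finite {g : ℕ} (w : Z2Star g) : (WleZ w).Finite := by
  by_cases hw : ∃ lw : List (Fin g), lw.IsChain (· ≠ ·) ∧ wordZ lw = w
  · obtain ⟨lw, hlw, rfl⟩ := hw
    refine ((List.finite_length_le (Fin g) lw.length).image wordZ).subset ?_
    rintro v ⟨la, lb, -, hlb, rfl, hb, hle⟩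
    obtain rfl := wordZ_injOn hlb hlw hb
    refine ⟨la, ?_, rfl⟩
    rcases hle with (h | h) | h
    · exact h.le
    · exact h.1.le
    · exact (congrArg List.length h).le
  · convert Set.finite_empty
    ext v
    simp only [Set.mem_empty_iff_false, iff_false]
    rintro ⟨la, lb, -, hlb, -, hb, -⟩
    exact hw ⟨lb, hlb, hb⟩

/-- Every element of `W_{≤ w}` is given by a word all of whose suffixes lie in `W_{≤ w}`. -/
theorem exists_word_suffix_mem_WleZ {g : ℕ} {w v : Z2Star g} (hv : v ∈ WleZ w) :
    ∃ l : List (Fin g), wordZ l = v ∧ ∀ l', l' <:+ l → wordZ l' ∈ WleZ w := by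
  obtain ⟨la, lb, hla, hlb, rfl, hb, hle⟩ := hv
  refine ⟨la, rfl, fun l' hl' => ⟨l', lb, hla.suffix hl', hlb, rfl, hb, ?_⟩⟩
  rcases hl'.length_le.lt_or_eq with h | h
  · refine Or.inl (Or.inl (h.trans_le ?_))
    rcases hle with (h | h) | h
    · exact h.le
    · exact h.1.le
    · exact (congrArg List.length h).le
  · rwa [hl'.eq_of_length h]

/-- A Gram matrix on `S × ι` which is Toeplitz with respect to the group structure is realized by
a unitary representation of `ℤ₂^{*g}`. -/
theorem exists_rep_of_toeplitz {g : ℕ} {F ι : Type*} [NormedAddCommGroup F]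
    [InnerProductSpace ℂ F] [FiniteDimensional ℂ F] (S : Set (Z2Star g)) (k : Z2Star g → ι → F)
    (hk : ∀ u ∈ S, ∀ v ∈ S, ∀ u' ∈ S, ∀ v' ∈ S, u⁻¹ * v = u'⁻¹ * v' →
      ∀ i j, ⟪k u i, k v j⟫ = ⟪k u' i, k v' j⟫) :
    ∃ π : Z2Star g →* (F ≃ₗᵢ[ℂ] F), ∀ l : List (Fin g), (∀ l', l' <:+ l → wordZ l' ∈ S) →
      ∀ j, π (wordZ l) (k 1 j) = k (wordZ l) j := by
  let N : Fin g → Submodule ℂ F := fun x =>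
    Submodule.span ℂ {f | ∃ s ∈ S, z2of x * s ∈ S ∧ ∃ j, f = k s j - k (z2of x * s) j}
  obtain ⟨π, hπ⟩ := exists_hom_z2of (fun x => (N x)ᗮ.reflection) fun x =>
    Submodule.reflection_mul_reflection _
  have step : ∀ x s, s ∈ S → z2of x * s ∈ S → ∀ j,
      (N x)ᗮ.reflection (k s j) = k (z2of x * s) j := by
    intro x s hs hxs j
    have h1 : (N x)ᗮ.reflection (k s j - k (z2of x * s) j) = -(k s j - k (z2of x * s) j) :=
      Submodule.reflection_mem_subspace_orthogonal_precomplement_eq_neg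
        (Submodule.subset_span ⟨s, hs, hxs, j, rfl⟩)
    have h2 : (N x)ᗮ.reflection (k s j + k (z2of x * s) j) = k s j + k (z2of x * s) j := by
      refine Submodule.reflection_mem_subspace_eq_self ?_
      rw [Submodule.mem_orthogonal]
      intro f hf
      induction hf using Submodule.span_induction with
      | mem f hf =>
        obtain ⟨t, ht, hxt, i, rfl⟩ := hf
        have e1 : ⟪k (z2of x * t) i, k (z2of x * s) j⟫ = ⟪k t i, k s j⟫ :=
          hk _ hxt _ hxs _ ht _ hs (by group) i j
        have e2 : ⟪k (z2of x * t) i, k s j⟫ = ⟪k t i, k (z2of x * s) j⟫ :=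
          hk _ hxt _ hs _ ht _ hxs (by rw [mul_inv_rev, z2of_inv, mul_assoc]) i j
        rw [inner_sub_left, inner_add_right, inner_add_right, e1, e2]
        ring
      | zero => simp
      | add f f' _ _ h h' => rw [inner_add_left, h, h', add_zero]
      | smul a f _ h => rw [inner_smul_left, h, mul_zero]
    rw [map_sub] at h1
    rw [map_add] at h2
    have h3 : (2 : ℂ) • (N x)ᗮ.reflection (k s j) = (2 : ℂ) • k (z2of x * s) j := by
      calc (2 : ℂ) • (N x)ᗮ.reflection (k s j)
          = ((N x)ᗮ.reflection (k s j) - (N x)ᗮ.reflection (k (z2of x * s) j))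
            + ((N x)ᗮ.reflection (k s j) + (N x)ᗮ.reflection (k (z2of x * s) j)) := by module
        _ = (2 : ℂ) • k (z2of x * s) j := by rw [h1, h2]; module
    exact smul_right_injective F (two_ne_zero (α := ℂ)) h3
  refine ⟨π, fun l hl j => ?_⟩
  induction l with
  | nil => simp
  | cons x t ih =>
    have ht : wordZ t ∈ S := hl t (List.suffix_cons x t)
    rw [wordZ_cons, map_mul, hπ]
    change (N x)ᗮ.reflection (π (wordZ t) (k 1 j)) = _
    rw [ih fun l' hl' => hl l' (hl'.trans (List.suffix_cons x t))]
    exact step x _ ht (by simpa using hl _ (List.suffix_refl _)) j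

open ComplexConjugate

/-- A complex-linear version of the M. Riesz extension theorem, for a space with a conjugation. -/
theorem exists_complex_riesz_extension {V : Type*} [AddCommGroup V] [Module ℂ V]
    (σ : V →ₛₗ[starRingEnd ℂ] V) (hσ : ∀ v, σ (σ v) = v) (s : PointedCone ℝ V)
    (hs : ∀ v, σ v = -v → v ∈ s) (hsσ : ∀ v ∈ s, σ v ∈ s)
    (D : Submodule ℂ V) (hD : ∀ v ∈ D, σ v ∈ D) (f : V →ₗ[ℂ] ℂ)
    (hf : ∀ d ∈ D, σ d = d → d ∈ s → 0 ≤ (f d).re ∧ (f d).im = 0)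
    (hcof : ∀ v, ∃ d ∈ D, σ d = d ∧ d ∈ s ∧ d + v ∈ s) :
    ∃ h : V →ₗ[ℂ] ℂ, (∀ d ∈ D, h d = f d) ∧ (∀ v ∈ s, 0 ≤ (h v).re) ∧
      ∀ v, h (σ v) = conj (h v) := by
  have him : ∀ d ∈ D, σ d = d → (f d).im = 0 := by
    intro d hd hdσ
    obtain ⟨e, he, heσ, hes, heds⟩ := hcof d
    have h1 := (hf e he heσ hes).2
    have h2 := (hf (e + d) (D.add_mem he hd) (by rw [map_add, heσ, hdσ]) heds).2
    rw [map_add, Complex.add_im, h1, zero_add] at h2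
    exact h2
  have hre : ∀ d ∈ D, σ d = -d → (f d).re = 0 := by
    intro d hd hdσ
    have := him (Complex.I • d) (D.smul_mem _ hd) (by simp [hdσ])
    simpa using this
  have hpos : ∀ d ∈ D, d ∈ s → 0 ≤ (f d).re := by
    intro d hd hds
    have h1 := (hf (d + σ d) (D.add_mem hd (hD d hd)) (by rw [map_add, hσ, add_comm])
      (s.add_mem hds (hsσ d hds))).1
    have h2 := hre (d - σ d) (D.sub_mem hd (hD d hd)) (by rw [map_sub, hσ, neg_sub])
    simp only [map_add, map_sub, Complex.add_re, Complex.sub_re] at h1 h2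
    linarith
  let fp : V →ₗ.[ℝ] ℝ :=
    ⟨D.restrictScalars ℝ, (Complex.reLm ∘ₗ f.restrictScalars ℝ) ∘ₗ (D.restrictScalars ℝ).subtype⟩
  obtain ⟨r, hr, hrs⟩ := riesz_extension s fp (fun x hx => hpos x x.2 hx) fun v => by
    obtain ⟨d, hd, -, -, hdv⟩ := hcof v
    exact ⟨⟨d, hd⟩, hdv⟩
  have hrD : ∀ d ∈ D, r d = (f d).re := fun d hd => hr ⟨d, hd⟩
  have hanti : ∀ v, σ v = -v → r v = 0 := by
    intro v hv
    have h1 := hrs v (hs v hv)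
    have h2 := hrs (-v) (hs (-v) (by rw [map_neg, hv]))
    rw [map_neg] at h2
    linarith
  have hrσ : ∀ v, r (σ v) = r v := by
    intro v
    have := hanti (σ v - v) (by rw [map_sub, hσ, neg_sub])
    rw [map_sub] at this
    linarith
  let h : V →ₗ[ℂ] ℂ :=
    { toFun := fun v => ⟨r v, -r (Complex.I • v)⟩
      map_add' := fun v v' => by
        apply Complex.ext <;> simp; ring
      map_smul' := fun z v => by
        have e1 : z • v = z.re • v + z.im • (Complex.I • v) := by
          conv_lhs => rw [← Complex.re_add_im z, add_smul, mul_smul]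
          rfl
        have e2 : Complex.I • z • v = z.re • (Complex.I • v) - z.im • v := by
          rw [e1, smul_add, smul_comm Complex.I z.re v, smul_comm Complex.I z.im,
            smul_smul Complex.I, Complex.I_mul_I, neg_one_smul, smul_neg, sub_eq_add_neg]
        apply Complex.ext
        · simp [e1]
        · simp only [e2]
          simp
          ring }
  have hh : ∀ v, h v = ⟨r v, -r (Complex.I • v)⟩ := fun v => rfl
  refine ⟨h, fun d hd => ?_, fun v hv => hrs v hv, fun v => ?_⟩
  · rw [hh, hrD d hd, hrD _ (D.smul_mem _ hd)]
    apply Complex.ext <;> simp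
  · have : Complex.I • σ v = -σ (Complex.I • v) := by simp
    rw [hh, hh, hrσ, this, map_neg, hrσ]
    apply Complex.ext <;> simp

/-- A scalar kernel which is Hermitian and positive semidefinite. -/
def IsPosKernel {κ : Type*} (P : κ → κ → ℂ) : Prop :=
  (∀ a b, P b a = conj (P a b)) ∧
    ∀ c : κ →₀ ℂ, 0 ≤ (c.sum fun a z => c.sum fun b w => conj z * w * P a b).re

/-- Kolmogorov decomposition of a positive semidefinite kernel. -/
theorem IsPosKernel.exists_gram {κ : Type} {P : κ → κ → ℂ} (hP : IsPosKernel P) :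
    ∃ (H : HilbertC) (k : κ → H.carrier), ∀ a b, ⟪k a, k b⟫ = P a b := by
  let core : PreInnerProductSpace.Core ℂ (κ →₀ ℂ) :=
    { inner := fun f h => f.sum fun a z => h.sum fun b w => conj z * w * P a b
      conj_inner_symm := fun f h => by
        rw [Finsupp.sum_comm]
        simp only [map_finsuppSum]
        congr! 4 with a b
        simp [hP.1 a, mul_comm]
      re_inner_nonneg := hP.2
      add_left := fun f f' h => by
        rw [Finsupp.sum_add_index'] <;> simp [← Finsupp.sum_add, add_mul]
      smul_left := fun f h r => by
        rw [Finsupp.sum_smul_index] <;> simp [Finsupp.mul_sum, ← mul_assoc] }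
  let : SeminormedAddCommGroup (κ →₀ ℂ) :=
    InnerProductSpace.Core.toSeminormedAddCommGroup (𝕜 := ℂ)
  let : InnerProductSpace ℂ (κ →₀ ℂ) := InnerProductSpace.ofCore core
  refine ⟨⟨UniformSpace.Completion (κ →₀ ℂ)⟩,
    fun a => ((Finsupp.single a 1 : κ →₀ ℂ) : UniformSpace.Completion (κ →₀ ℂ)), fun a b => ?_⟩
  rw [UniformSpace.Completion.inner_coe]
  change ((Finsupp.single a 1).sum fun a z => (Finsupp.single b 1).sum
    fun b w => conj z * w * P a b) = _
  simp

/-- The conjugate transpose of a finitely supported matrix. -/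
noncomputable def finsuppConjTranspose (κ : Type*) :
    (κ × κ →₀ ℂ) →ₛₗ[starRingEnd ℂ] (κ × κ →₀ ℂ) where
  toFun X := (X.equivMapDomain (Equiv.prodComm κ κ)).mapRange (starRingEnd ℂ) (map_zero _)
  map_add' X Y := by ext; simp
  map_smul' z X := by ext; simp

@[simp] theorem finsuppConjTranspose_apply {κ : Type*} (X : κ × κ →₀ ℂ) (a b : κ) :
    finsuppConjTranspose κ X (a, b) = conj (X (b, a)) := rfl

theorem finsuppConjTranspose_single {κ : Type*} (a b : κ) (z : ℂ) :
    finsuppConjTranspose κ (Finsupp.single (a, b) z) = Finsupp.single (b, a) (conj z) := by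
  change (Finsupp.equivMapDomain (Equiv.prodComm κ κ) _).mapRange (starRingEnd ℂ) (map_zero _) = _
  rw [Finsupp.equivMapDomain_single, Finsupp.mapRange_single]
  rfl

theorem finsuppConjTranspose_involutive {κ : Type*} (X : κ × κ →₀ ℂ) :
    finsuppConjTranspose κ (finsuppConjTranspose κ X) = X := by
  ext ⟨a, b⟩
  simp

/-- The value at `c` of the quadratic form attached to a finitely supported matrix. -/
noncomputable def finsuppQuadForm {κ : Type*} (c : κ →₀ ℂ) : (κ × κ →₀ ℂ) →ₗ[ℂ] ℂ :=
  Finsupp.linearCombination ℂ fun ab => conj (c ab.1) * c ab.2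

theorem finsuppQuadForm_single {κ : Type*} (c : κ →₀ ℂ) (a b : κ) (z : ℂ) :
    finsuppQuadForm c (Finsupp.single (a, b) z) = z * (conj (c a) * c b) := by
  simp [finsuppQuadForm]

theorem finsuppQuadForm_conjTranspose {κ : Type*} (c : κ →₀ ℂ) (X : κ × κ →₀ ℂ) :
    finsuppQuadForm c (finsuppConjTranspose κ X) = conj (finsuppQuadForm c X) := by
  induction X using Finsupp.induction_linear with
  | zero => simp
  | add X Y hX hY => simp only [map_add, hX, hY]
  | single ab z =>
    obtain ⟨a, b⟩ := ab
    rw [finsuppConjTranspose_single, finsuppQuadForm_single, finsuppQuadForm_single]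
    simp [mul_comm]

theorem finsuppQuadForm_eq_sum {κ : Type*} (c : κ →₀ ℂ) (X : κ × κ →₀ ℂ) :
    finsuppQuadForm c X = c.sum fun a z => c.sum fun b w => conj z * w * X (a, b) := by
  classical
  induction X using Finsupp.induction_linear with
  | zero => simp
  | add X Y hX hY =>
    rw [map_add, hX, hY]
    simp only [Finsupp.sum, ← Finset.sum_add_distrib, Finsupp.add_apply, mul_add]
  | single ab z =>
    obtain ⟨a, b⟩ := ab
    rw [finsuppQuadForm_single]
    have h : ∀ x y, conj (c x) * c y * Finsupp.single (a, b) z (x, y) =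
        if x = a then (if y = b then conj (c a) * c b * z else 0) else 0 := by
      intro x y
      rw [Finsupp.single_apply]
      by_cases hx : x = a
      · by_cases hy : y = b
        · simp [hx, hy]
        · simp [hy, Ne.symm hy]
      · simp [hx, Ne.symm hx]
    simp only [Finsupp.sum, h]
    by_cases ha : c a = 0
    · simp [ha]
    by_cases hb : c b = 0
    · simp [hb]
    rw [Finset.sum_eq_single a (fun x _ hx => by simp [hx]) (by simp [ha]),
      Finset.sum_eq_single b (fun x _ hx => by simp [hx]) (by simp [hb])]
    simp
    ring

/-- The cone of finitely supported matrices whose quadratic form has nonnegative real part. -/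
noncomputable def finsuppAccretive (κ : Type*) : PointedCone ℝ (κ × κ →₀ ℂ) where
  carrier := {X | ∀ c, 0 ≤ (finsuppQuadForm c X).re}
  add_mem' hX hY c := by
    rw [map_add, Complex.add_re]
    exact add_nonneg (hX c) (hY c)
  zero_mem' c := by simp
  smul_mem' r X hX c := by
    have : finsuppQuadForm c (r • X) = ((r : ℝ) : ℂ) * finsuppQuadForm c X :=
      (finsuppQuadForm c).map_smul ((r : ℝ) : ℂ) X
    rw [this, Complex.re_ofReal_mul]
    exact mul_nonneg r.2 (hX c)

theorem single_mem_finsuppAccretive {κ : Type*} (a : κ) {r : ℝ} (hr : 0 ≤ r) :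
    Finsupp.single (a, a) (r : ℂ) ∈ finsuppAccretive κ := by
  intro c
  rw [finsuppQuadForm_single, Complex.re_ofReal_mul, ← Complex.normSq_eq_conj_mul_self]
  exact mul_nonneg hr (Complex.normSq_nonneg _)

theorem single_add_single_mem_finsuppAccretive {κ : Type*} (a b : κ) (z : ℂ) :
    Finsupp.single (a, a) (‖z‖ : ℂ) + Finsupp.single (b, b) (‖z‖ : ℂ) + Finsupp.single (a, b) z
      ∈ finsuppAccretive κ := by
  intro c
  simp only [map_add, finsuppQuadForm_single, Complex.add_re, Complex.re_ofReal_mul,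
    ← Complex.normSq_eq_conj_mul_self, Complex.ofReal_re, Complex.normSq_eq_norm_sq]
  have h1 : -(‖z‖ * (‖c a‖ * ‖c b‖)) ≤ (z * (conj (c a) * c b)).re := by
    have := Complex.abs_re_le_norm (z * (conj (c a) * c b))
    rw [norm_mul, norm_mul, RCLike.norm_conj] at this
    exact (abs_le.1 this).1
  nlinarith [mul_nonneg (norm_nonneg z) (sq_nonneg (‖c a‖ - ‖c b‖)),
    mul_nonneg (norm_nonneg z) (sq_nonneg (‖c a‖)), mul_nonneg (norm_nonneg z) (sq_nonneg (‖c b‖))]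

/-- A linear functional nonnegative on accretive matrices is given by a positive kernel. -/
theorem isPosKernel_of_nonneg {κ : Type*} (h : (κ × κ →₀ ℂ) →ₗ[ℂ] ℂ)
    (hpos : ∀ X ∈ finsuppAccretive κ, 0 ≤ (h X).re)
    (hσ : ∀ X, h (finsuppConjTranspose κ X) = conj (h X)) :
    IsPosKernel fun a b => h (Finsupp.single (a, b) 1) := by
  refine ⟨fun a b => ?_, fun c => ?_⟩
  · rw [← hσ, finsuppConjTranspose_single, map_one]
  · let R : κ × κ →₀ ℂ :=
      c.sum fun a z => c.sum fun b w => Finsupp.single (a, b) (conj z * w)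
    have hR : ∀ L : (κ × κ →₀ ℂ) →ₗ[ℂ] ℂ, L R =
        c.sum fun a z => c.sum fun b w => conj z * w * L (Finsupp.single (a, b) 1) := by
      intro L
      simp only [R, map_finsuppSum]
      refine Finsupp.sum_congr fun a _ => Finsupp.sum_congr fun b _ => ?_
      rw [← smul_eq_mul (conj _ * _), ← map_smul, Finsupp.smul_single_one]
    rw [← hR h]
    refine hpos R fun d => ?_
    rw [hR]
    have : (c.sum fun a z => c.sum fun b w =>
        conj z * w * finsuppQuadForm d (Finsupp.single (a, b) 1)) =
        conj (c.sum fun a z => z * d a) * (c.sum fun a z => z * d a) := by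
      simp only [finsuppQuadForm_single, Finsupp.sum, map_sum, Finset.sum_mul_sum, map_mul]
      refine Finset.sum_congr rfl fun a _ => Finset.sum_congr rfl fun b _ => ?_
      ring
    rw [this, ← Complex.normSq_eq_conj_mul_self, Complex.ofReal_re]
    exact Complex.normSq_nonneg _

/-- The finitely supported matrices over `W × I` which are Toeplitz in the `W` variables. -/
def finsuppToeplitz {G : Type*} [Group G] (W : Finset G) (I : Type*) :
    Submodule ℂ ((W × I) × (W × I) →₀ ℂ) where
  carrier := {X | ∀ u v u' v' : W, (u : G)⁻¹ * v = (u' : G)⁻¹ * v' → ∀ i j,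
    X ((u, i), (v, j)) = X ((u', i), (v', j))}
  add_mem' hX hY u v u' v' huv i j := by
    rw [Finsupp.add_apply, Finsupp.add_apply, hX u v u' v' huv, hY u v u' v' huv]
  zero_mem' u v u' v' huv i j := rfl
  smul_mem' z X hX u v u' v' huv i j := by
    rw [Finsupp.smul_apply, Finsupp.smul_apply, hX u v u' v' huv]

theorem conjTranspose_mem_finsuppToeplitz {G I : Type*} [Group G] {W : Finset G}
    {X : (W × I) × (W × I) →₀ ℂ} (hX : X ∈ finsuppToeplitz W I) :
    finsuppConjTranspose _ X ∈ finsuppToeplitz W I := by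
  intro u v u' v' huv i j
  rw [finsuppConjTranspose_apply, finsuppConjTranspose_apply, hX v u v' u']
  simpa using congrArg (·⁻¹) huv

/-- The matrix supported on the pairs `((u, i), (v, j))` with `u⁻¹ * v = α`, where it equals
`z`. -/
noncomputable def finsuppToeplitzSingle {G I : Type*} [Group G] [DecidableEq G] (W : Finset G)
    (α : G) (i j : I) (z : ℂ) : (W × I) × (W × I) →₀ ℂ :=
  ∑ p : W × W with (p.1 : G)⁻¹ * p.2 = α, Finsupp.single ((p.1, i), (p.2, j)) z

theorem finsuppToeplitzSingle_apply {G I : Type*} [Group G] [DecidableEq G] [DecidableEq I]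
    (W : Finset G) (α : G) (i j i' j' : I) (z : ℂ) (u v : W) :
    finsuppToeplitzSingle W α i j z ((u, i'), (v, j')) =
      if (u : G)⁻¹ * v = α ∧ i = i' ∧ j = j' then z else 0 := by
  rw [finsuppToeplitzSingle, Finsupp.finsetSum_apply]
  have : ∀ p : W × W, (Finsupp.single ((p.1, i), (p.2, j)) z : (W × I) × (W × I) →₀ ℂ)
      ((u, i'), (v, j')) = if p = (u, v) then (if i = i' ∧ j = j' then z else 0) else 0 := by
    rintro ⟨p, q⟩
    rw [Finsupp.single_apply, ← ite_and]
    refine if_congr ?_ rfl rfl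
    simp only [Prod.mk.injEq]
    tauto
  simp only [this, Finset.sum_ite_eq', Finset.mem_filter, Finset.mem_univ, true_and]
  rw [← ite_and]

theorem finsuppToeplitzSingle_mem {G I : Type*} [Group G] [DecidableEq G]
    (W : Finset G) (α : G) (i j : I) (z : ℂ) :
    finsuppToeplitzSingle W α i j z ∈ finsuppToeplitz W I := by
  classical
  intro u v u' v' huv i' j'
  rw [finsuppToeplitzSingle_apply, finsuppToeplitzSingle_apply, huv]

theorem finsuppToeplitzSingle_one {G I : Type*} [Group G] [DecidableEq G]
    (W : Finset G) (i j : I) (z : ℂ) :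
    finsuppToeplitzSingle W 1 i j z = ∑ u : W, Finsupp.single ((u, i), (u, j)) z := by
  symm
  refine Finset.sum_of_injOn (fun u : W => (u, u)) (fun u _ v _ h => (Prod.mk.inj h).1)
    (by simp [Set.MapsTo]) ?_ (fun _ _ => rfl)
  rintro ⟨u, v⟩ h h'
  refine absurd ⟨u, by simp, ?_⟩ h'
  rw [Finset.mem_filter] at h
  exact Prod.ext rfl (Subtype.ext (inv_mul_eq_one.1 h.2))

/-- The pairing of a matrix over `W × I` with coefficients `t`, normalized so that on Toeplitz
matrices every element `u⁻¹ * v` of the group is counted once. -/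
noncomputable def toeplitzPairing {G I : Type*} [Group G] [DecidableEq G] (W : Finset G)
    (t : G → I → I → ℂ) : ((W × I) × (W × I) →₀ ℂ) →ₗ[ℂ] ℂ :=
  Finsupp.linearCombination ℂ fun ab =>
    t ((ab.1.1 : G)⁻¹ * ab.2.1) ab.1.2 ab.2.2 /
      Finset.card {p : W × W | (p.1 : G)⁻¹ * p.2 = (ab.1.1 : G)⁻¹ * ab.2.1}

/-- Duality between positive kernels and positive semidefinite Toeplitz matrices. -/
theorem exists_isPosKernel_of_toeplitz_nonneg {G I : Type*} [Group G] [DecidableEq G]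
    (W : Finset G) (t : G → I → I → ℂ)
    (ht : ∀ X ∈ finsuppToeplitz W I, finsuppConjTranspose _ X = X → X ∈ finsuppAccretive (W × I) →
      0 ≤ (toeplitzPairing W t X).re ∧ (toeplitzPairing W t X).im = 0) :
    ∃ P : W × I → W × I → ℂ, IsPosKernel P ∧
      ∀ u v : W, ∀ i j, ∑ p : W × W with (p.1 : G)⁻¹ * p.2 = (u : G)⁻¹ * v,
        P (p.1, i) (p.2, j) = t ((u : G)⁻¹ * v) i j := by
  obtain ⟨h, hD, hpos, hσ⟩ := exists_complex_riesz_extension (finsuppConjTranspose (W × I))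
    finsuppConjTranspose_involutive (finsuppAccretive (W × I)) (fun X hX c => by
      have := finsuppQuadForm_conjTranspose c X
      rw [hX, map_neg] at this
      have := congrArg Complex.re this
      simp only [Complex.neg_re, Complex.conj_re] at this
      linarith) (fun X hX c => by
      rw [finsuppQuadForm_conjTranspose, Complex.conj_re]
      exact hX c) (finsuppToeplitz W I) (fun X => conjTranspose_mem_finsuppToeplitz)
    (toeplitzPairing W t) ht
    (fun X => by
      have hdiag : ∀ i (r : ℝ), 0 ≤ r →
          finsuppToeplitzSingle W 1 i i (r : ℂ) ∈ finsuppAccretive (W × I) := by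
        intro i r hr
        rw [finsuppToeplitzSingle_one]
        exact sum_mem fun u _ => single_mem_finsuppAccretive _ hr
      have hself : ∀ (i : I) (r : ℝ),
          finsuppConjTranspose _ (finsuppToeplitzSingle W 1 i i (r : ℂ)) =
            finsuppToeplitzSingle W 1 i i (r : ℂ) := by
        intro i r
        simp [finsuppToeplitzSingle_one, finsuppConjTranspose_single]
      have hdiff : ∀ u i (r : ℝ), 0 ≤ r → finsuppToeplitzSingle W 1 i i (r : ℂ) -
          Finsupp.single ((u, i), (u, i)) (r : ℂ) ∈ finsuppAccretive (W × I) := by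
        intro u i r hr
        rw [finsuppToeplitzSingle_one, ← Finset.add_sum_erase _ _ (Finset.mem_univ u),
          add_sub_cancel_left]
        exact sum_mem fun u _ => single_mem_finsuppAccretive _ hr
      induction X using Finsupp.induction_linear with
      | zero => exact ⟨0, zero_mem _, map_zero _, zero_mem _, by simp⟩
      | add X Y hX hY =>
        obtain ⟨d, h1, h2, h3, h4⟩ := hX
        obtain ⟨e, h1', h2', h3', h4'⟩ := hY
        refine ⟨d + e, add_mem h1 h1', by rw [map_add, h2, h2'], add_mem h3 h3', ?_⟩
        rw [add_add_add_comm]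
        exact add_mem h4 h4'
      | single ab z =>
        obtain ⟨⟨u, i⟩, ⟨v, j⟩⟩ := ab
        have hz := norm_nonneg z
        refine ⟨finsuppToeplitzSingle W 1 i i (‖z‖ : ℂ) + finsuppToeplitzSingle W 1 j j (‖z‖ : ℂ),
          add_mem (finsuppToeplitzSingle_mem _ _ _ _ _) (finsuppToeplitzSingle_mem _ _ _ _ _),
          by rw [map_add, hself, hself], add_mem (hdiag _ _ hz) (hdiag _ _ hz), ?_⟩
        convert add_mem (add_mem (hdiff u i ‖z‖ hz) (hdiff v j ‖z‖ hz))
          (single_add_single_mem_finsuppAccretive (u, i) (v, j) z) using 1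
        abel)
  refine ⟨_, isPosKernel_of_nonneg h hpos hσ, fun u v i j => ?_⟩
  have key := hD _ (finsuppToeplitzSingle_mem W ((u : G)⁻¹ * v) i j 1)
  rw [finsuppToeplitzSingle, map_sum, map_sum] at key
  rw [key]
  have : ∀ p ∈ Finset.univ.filter fun p : W × W => (p.1 : G)⁻¹ * p.2 = (u : G)⁻¹ * v,
      toeplitzPairing W t (Finsupp.single ((p.1, i), (p.2, j)) 1) = t ((u : G)⁻¹ * v) i j /
          Finset.card {p : W × W | (p.1 : G)⁻¹ * p.2 = (u : G)⁻¹ * v} := by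
    intro p hp
    rw [Finset.mem_filter] at hp
    simp [toeplitzPairing, hp.2]
  rw [Finset.sum_congr rfl this, Finset.sum_const, nsmul_eq_mul, mul_div_cancel₀]
  rw [Nat.cast_ne_zero, Finset.card_ne_zero]
  exact ⟨(u, v), by simp⟩

theorem Finset.sum_div_card_fiber {ι α : Type*} [Fintype ι] [DecidableEq α] (q : ι → α)
    (φ : α → ℂ) : ∑ p, φ (q p) / Finset.card {p' | q p' = q p} = ∑ a ∈ univ.image q, φ a := by
  rw [← Finset.sum_fiberwise_of_maps_to (fun p _ => mem_image_of_mem q (mem_univ p))]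
  refine Finset.sum_congr rfl fun a ha => ?_
  have : ∀ p ∈ univ.filter (fun p => q p = a), φ (q p) / Finset.card {p' | q p' = q p} =
      φ a / Finset.card {p' | q p' = a} := by
    intro p hp
    rw [(mem_filter.1 hp).2]
  rw [Finset.sum_congr rfl this, Finset.sum_const, nsmul_eq_mul, mul_div_cancel₀]
  obtain ⟨p, -, hp⟩ := mem_image.1 ha
  rw [Nat.cast_ne_zero, Finset.card_ne_zero]
  exact ⟨p, by simpa using hp⟩

/-- A positive semidefinite Toeplitz matrix over `W_{≤ w}` is a compression of a unitary
representation of `ℤ₂^{*g}` on a finite-dimensional space. -/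
theorem exists_rep_of_mem_finsuppToeplitz {g : ℕ} {w : Z2Star g} {W : Finset (Z2Star g)}
    (hW : ∀ v, v ∈ W ↔ v ∈ WleZ w) {I : Type} (J : Finset I) (X : (W × I) × (W × I) →₀ ℂ)
    (hX : X ∈ finsuppToeplitz W I) (hXσ : finsuppConjTranspose _ X = X)
    (hXs : X ∈ finsuppAccretive (W × I)) :
    ∃ (F : HilbertC) (_ : FiniteDimensional ℂ F.carrier)
      (π : Z2Star g →* (F.carrier ≃ₗᵢ[ℂ] F.carrier)) (f : J → F.carrier),
      ∀ u v : W, ∀ i j : J, ⟪f i, π ((u : Z2Star g)⁻¹ * v) (f j)⟫ = X ((u, i), (v, j)) := by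
  classical
  have hker : IsPosKernel fun a b => X (a, b) := by
    refine ⟨fun a b => ?_, fun c => ?_⟩
    · rw [← finsuppConjTranspose_apply, hXσ]
    · rw [← finsuppQuadForm_eq_sum]
      exact hXs c
  obtain ⟨H, k, hk⟩ := hker.exists_gram
  let N : Submodule ℂ H.carrier :=
    Submodule.span ℂ (Set.range fun q : W × J => k (q.1, q.2))
  have hN : FiniteDimensional ℂ N := FiniteDimensional.span_of_finite ℂ (Set.finite_range _)
  let k' : Z2Star g → J → N := fun u j =>
    if h : u ∈ W then ⟨k (⟨u, h⟩, j), Submodule.subset_span ⟨(⟨u, h⟩, j), rfl⟩⟩ else 0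
  have hk' : ∀ u v : W, ∀ i j, ⟪k' u i, k' v j⟫ = X ((u, i), (v, j)) := by
    intro u v i j
    simp only [k', u.2, v.2, dif_pos, Submodule.coe_inner]
    exact hk _ _
  obtain ⟨π, hπ⟩ := exists_rep_of_toeplitz (WleZ w) k' fun u hu v hv u' hu' v' hv' huv i j => by
    rw [← hW] at hu hv hu' hv'
    rw [hk' ⟨u, hu⟩ ⟨v, hv⟩, hk' ⟨u', hu'⟩ ⟨v', hv'⟩]
    exact hX _ _ _ _ huv _ _
  have hπ' : ∀ (u : W) j, π u (k' 1 j) = k' u j := by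
    intro u j
    obtain ⟨l, hl, hl'⟩ := exists_word_suffix_mem_WleZ ((hW u).1 u.2)
    rw [← hl]
    exact hπ l hl' j
  refine ⟨⟨N⟩, hN, π, k' 1, fun u v i j => ?_⟩
  rw [← hk', ← hπ', ← hπ', ← (π u).inner_map_map, map_mul, map_inv]
  congr 1
  exact (π u).apply_symm_apply _

/-- Vectors with prescribed Toeplitz sums of inner products on a basis define bounded operators
with prescribed Toeplitz sums of products. -/
theorem exists_operators_of_gram {G I E H : Type*} [Group G] [DecidableEq G] (W : Finset G)
    [NormedAddCommGroup E] [InnerProductSpace ℂ E] [NormedAddCommGroup H] [InnerProductSpace ℂ H]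
    (A : G → E →L[ℂ] E) (b : Module.Basis I ℂ E) (k : W × I → H)
    (hk : ∀ u v : W, ∀ i j, ∑ p : W × W with (p.1 : G)⁻¹ * p.2 = (u : G)⁻¹ * v,
      ⟪k (p.1, i), k (p.2, j)⟫ = ⟪b i, A ((u : G)⁻¹ * v) (b j)⟫) :
    ∃ B : W → E →L[ℂ] H, ∀ u v : W, ∀ x y,
      ∑ p : W × W with (p.1 : G)⁻¹ * p.2 = (u : G)⁻¹ * v, ⟪B p.1 x, B p.2 y⟫ =
        ⟪x, A ((u : G)⁻¹ * v) y⟫ := by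
  let L : W → E →ₗ[ℂ] H := fun u => b.constr ℂ fun i => k (u, i)
  have hL : ∀ u v : W, ∀ x y,
      ∑ p : W × W with (p.1 : G)⁻¹ * p.2 = (u : G)⁻¹ * v, ⟪L p.1 x, L p.2 y⟫ =
        ⟪x, A ((u : G)⁻¹ * v) y⟫ := by
    intro u v x y
    have hx : x ∈ Submodule.span ℂ (Set.range b) := b.mem_span x
    have hy : y ∈ Submodule.span ℂ (Set.range b) := b.mem_span y
    induction hx using Submodule.span_induction with
    | zero => simp
    | add x x' _ _ h h' => simp only [map_add, inner_add_left, Finset.sum_add_distrib, h, h']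
    | smul z x _ h => simp only [map_smul, inner_smul_left, ← Finset.mul_sum, h]
    | mem x hx =>
      obtain ⟨i, rfl⟩ := hx
      induction hy using Submodule.span_induction with
      | zero => simp
      | add y y' _ _ h h' => simp only [map_add, inner_add_right, Finset.sum_add_distrib, h, h']
      | smul z y _ h => simp only [map_smul, inner_smul_right, ← Finset.mul_sum, h]
      | mem y hy =>
        obtain ⟨j, rfl⟩ := hy
        simpa only [L, Module.Basis.constr_basis] using hk u v i j
  have hbound : ∀ u x, ‖L u x‖ ≤ √‖A 1‖ * ‖x‖ := by
    intro u x
    refine (sq_le_sq₀ (norm_nonneg _) (by positivity)).1 ?_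
    rw [mul_pow, Real.sq_sqrt (norm_nonneg _)]
    have h1 := congrArg Complex.re (hL u u x x)
    rw [inv_mul_cancel, Complex.re_sum] at h1
    have h0 : ∀ p ∈ Finset.univ.filter fun p : W × W => (p.1 : G)⁻¹ * p.2 = 1,
        (⟪L p.1 x, L p.2 x⟫).re = ‖L p.1 x‖ ^ 2 := by
      rintro ⟨p, q⟩ hp
      obtain rfl : p = q := Subtype.ext (inv_mul_eq_one.1 (Finset.mem_filter.1 hp).2)
      exact inner_self_eq_norm_sq (𝕜 := ℂ) (L p x)
    rw [Finset.sum_congr rfl h0] at h1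
    have hmem : (u, u) ∈ Finset.univ.filter fun p : W × W => (p.1 : G)⁻¹ * p.2 = 1 :=
      Finset.mem_filter.2 ⟨Finset.mem_univ _, inv_mul_cancel _⟩
    have hle := Finset.single_le_sum (f := fun p : W × W => ‖L p.1 x‖ ^ 2)
      (fun _ _ => sq_nonneg _) hmem
    calc ‖L u x‖ ^ 2 ≤ ∑ p : W × W with (p.1 : G)⁻¹ * p.2 = 1, ‖L p.1 x‖ ^ 2 :=
          hle
      _ = (⟪x, A 1 x⟫).re := h1
      _ ≤ ‖⟪x, A 1 x⟫‖ := Complex.re_le_norm _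
      _ ≤ ‖x‖ * ‖A 1 x‖ := norm_inner_le_norm _ _
      _ ≤ ‖x‖ * (‖A 1‖ * ‖x‖) := by gcongr; exact (A 1).le_opNorm x
      _ = ‖A 1‖ * ‖x‖ ^ 2 := by ring
  exact ⟨fun u => (L u).mkContinuous _ (hbound u), hL⟩

/-- Group algebra Positivstellensatz for `ℤ₂^{*g}`, with operator coefficients. -/
theorem stmt2
    (g : ℕ) (hg : 0 < g) (w : Z2Star g)
    (E : Type) [NormedAddCommGroup E] [InnerProductSpace ℂ E] [CompleteSpace E]
    (A : Z2Star g → (E →L[ℂ] E))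
    (hpos : ∀ (F : Type) [NormedAddCommGroup F] [InnerProductSpace ℂ F]
        [CompleteSpace F] [TopologicalSpace.SeparableSpace F]
        (π : Z2Star g →* (F ≃ₗᵢ[ℂ] F)) (n : ℕ) (e : Fin n → E) (f : Fin n → F),
        0 ≤ (∑ᶠ u ∈ HerWleZ w,
              ∑ i : Fin n, ∑ j : Fin n, ⟪e i, A u (e j)⟫ * ⟪f i, π u (f j)⟫).re ∧
        (∑ᶠ u ∈ HerWleZ w,
              ∑ i : Fin n, ∑ j : Fin n, ⟪e i, A u (e j)⟫ * ⟪f i, π u (f j)⟫).im = 0) :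
    ∃ E' : HilbertC, ∃ B : Z2Star g → (E →L[ℂ] E'.carrier),
      ∀ α ∈ HerWleZ w,
        A α = ∑ᶠ u ∈ WleZ w,
                ∑ᶠ v ∈ {v : Z2Star g | v ∈ WleZ w ∧ u⁻¹ * v = α},
                  (ContinuousLinearMap.adjoint (B u)).comp (B v) := by
  classical
  let W := (WleZ_finite w).toFinset
  have hW : ∀ v, v ∈ W ↔ v ∈ WleZ w := fun v => (WleZ_finite w).mem_toFinset
  have hWcoe : WleZ w = ↑W := (WleZ_finite w).coe_toFinset.symm
  have hHer : HerWleZ w = ↑(Finset.univ.image fun p : W × W => (p.1 : Z2Star g)⁻¹ * p.2) := by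
    ext α
    constructor
    · rintro ⟨u, hu, v, hv, rfl⟩
      exact Finset.mem_coe.2 (Finset.mem_image.2
        ⟨(⟨u, (hW u).2 hu⟩, ⟨v, (hW v).2 hv⟩), Finset.mem_univ _, rfl⟩)
    · intro h
      obtain ⟨p, -, rfl⟩ := Finset.mem_image.1 (Finset.mem_coe.1 h)
      exact ⟨p.1, (hW _).1 p.1.2, p.2, (hW _).1 p.2.2, rfl⟩
  let b := Module.Basis.ofVectorSpace ℂ E
  obtain ⟨P, hP, hPsum⟩ := exists_isPosKernel_of_toeplitz_nonneg W
    (fun α i j => ⟪b i, A α (b j)⟫) fun X hX hXσ hXs => by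
      let J := X.support.image (fun ab => ab.1.2) ∪ X.support.image (fun ab => ab.2.2)
      obtain ⟨F, hF, π, f, hf⟩ := exists_rep_of_mem_finsuppToeplitz hW J X hX hXσ hXs
      have hsum : toeplitzPairing W (fun α i j => ⟪b i, A α (b j)⟫) X =
          ∑ᶠ u ∈ HerWleZ w, ∑ i : Fin (Fintype.card J), ∑ j : Fin (Fintype.card J),
            ⟪b ((Fintype.equivFin J).symm i), A u (b ((Fintype.equivFin J).symm j))⟫ *
              ⟪f ((Fintype.equivFin J).symm i), π u (f ((Fintype.equivFin J).symm j))⟫ := by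
        have hcard : ∀ u, ∑ i : Fin (Fintype.card J), ∑ j : Fin (Fintype.card J),
            ⟪b ((Fintype.equivFin J).symm i), A u (b ((Fintype.equivFin J).symm j))⟫ *
              ⟪f ((Fintype.equivFin J).symm i), π u (f ((Fintype.equivFin J).symm j))⟫ =
            ∑ i : J, ∑ j : J, ⟪b i, A u (b j)⟫ * ⟪f i, π u (f j)⟫ := fun u =>
          Fintype.sum_equiv (Fintype.equivFin J).symm _ _ fun i =>
            Fintype.sum_equiv (Fintype.equivFin J).symm _ _ fun j => rfl
        simp only [hcard]
        rw [hHer, finsum_mem_coe_finset, ← Finset.sum_div_card_fiber, toeplitzPairing,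
          Finsupp.linearCombination_apply]
        let ψ : (W × W) × (J × J) →
            (W × Module.Basis.ofVectorSpaceIndex ℂ E) × (W × Module.Basis.ofVectorSpaceIndex ℂ E) :=
          fun q => ((q.1.1, q.2.1), (q.1.2, q.2.2))
        have hψ : Function.Injective ψ := by
          rintro ⟨⟨u, v⟩, i, j⟩ ⟨⟨u', v'⟩, i', j'⟩ h
          simp only [ψ, Prod.mk.injEq] at h
          obtain ⟨⟨rfl, h1⟩, rfl, h2⟩ := h
          rw [Subtype.ext h1, Subtype.ext h2]
        rw [Finsupp.sum_of_support_subset X (s := Finset.univ.map ⟨ψ, hψ⟩) _ _ (by simp),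
          Finset.sum_map, Fintype.sum_prod_type]
        · refine Finset.sum_congr rfl fun p _ => ?_
          rw [Finset.sum_div, Fintype.sum_prod_type]
          refine Finset.sum_congr rfl fun i _ => ?_
          rw [Finset.sum_div]
          refine Finset.sum_congr rfl fun j _ => ?_
          rw [hf p.1 p.2 i j]
          simp only [ψ, Function.Embedding.coeFn_mk, smul_eq_mul]
          ring
        · rintro ⟨⟨u, i⟩, ⟨v, j⟩⟩ h
          refine Finset.mem_map.2 ⟨((u, v), (⟨i, ?_⟩, ⟨j, ?_⟩)), Finset.mem_univ _, rfl⟩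
          · exact Finset.mem_union_left _ (Finset.mem_image.2 ⟨_, h, rfl⟩)
          · exact Finset.mem_union_right _ (Finset.mem_image.2 ⟨_, h, rfl⟩)
      rw [hsum]
      have : ProperSpace F.carrier := FiniteDimensional.proper ℂ F.carrier
      exact hpos F.carrier π _ (fun i => b ((Fintype.equivFin J).symm i))
        fun i => f ((Fintype.equivFin J).symm i)
  obtain ⟨H, k, hk⟩ := hP.exists_gram
  obtain ⟨B, hB⟩ := exists_operators_of_gram W A b k fun u v i j => by
    simp only [hk]
    exact hPsum u v i j
  refine ⟨H, fun u => if h : u ∈ W then B ⟨u, h⟩ else 0, fun α hα => ?_⟩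
  rw [hHer] at hα
  obtain ⟨⟨u, v⟩, -, rfl⟩ := Finset.mem_image.1 (Finset.mem_coe.1 hα)
  have hset : ∀ u' : Z2Star g, {v' : Z2Star g | v' ∈ WleZ w ∧ u'⁻¹ * v' = (u : Z2Star g)⁻¹ * v} =
      ↑(W.filter fun v' => u'⁻¹ * v' = (u : Z2Star g)⁻¹ * v) := by
    intro u'
    ext v'
    simp [hW]
  simp only [hset, finsum_mem_coe_finset]
  rw [hWcoe, finsum_mem_coe_finset]
  ext y
  refine ext_inner_left ℂ fun x => ?_
  rw [← hB u v x y, Finset.sum_filter, Fintype.sum_prod_type]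
  simp only [sum_apply, inner_sum, Finset.sum_filter]
  rw [← Finset.sum_coe_sort W]
  refine Finset.sum_congr rfl fun u' _ => ?_
  rw [← Finset.sum_coe_sort W]
  refine Finset.sum_congr rfl fun v' _ => ?_
  rw [dif_pos u'.2, dif_pos v'.2]
  by_cases h : (u' : Z2Star g)⁻¹ * v' = (u : Z2Star g)⁻¹ * v
  · simp [h, ContinuousLinearMap.adjoint_inner_right]
  · simp [h]
end
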